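/- arXiv:2311.11332 — 7 statements merged into one kernel-verified Lean document; each statement's English description precedes it below -/
import Mathlib

section
/- Let G be a metric complete graph on n vertices where k ≥ 3 divides n. Then the maximum weight of a Hamiltonian cycle H* satisfies w(H*) ≥ (1 - 1/(2k))·w(C*_k), where C*_k is a maximum-weight k-cycle packing. -/
open Finset

/-- Total weight of the `k`-cycle packing represented by a bijection
`f : Fin m × Fin k ≃ Fin n` (cycle `i` visits `f (i,0), f (i,1), …, f (i,k-1)` cyclically). -/
noncomputable def cycleW {n m k : ℕ} (w : Fin n → Fin n → ℝ) (f : Fin m × Fin k ≃ Fin n) : ℝ :=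
  ∑ i : Fin m, ∑ j : Fin k, w (f (i, j)) (f (i, finRotate k j))

/-- Total weight of the `k`-path packing represented by a bijection
`f : Fin m × Fin k ≃ Fin n` (path `i` is `f (i,0), f (i,1), …, f (i,k-1)`). -/
noncomputable def pathW {n m k : ℕ} (w : Fin n → Fin n → ℝ) (f : Fin m × Fin k ≃ Fin n) : ℝ :=
  ∑ i : Fin m, ∑ j : Fin k,
    if (j : ℕ) + 1 < k then w (f (i, j)) (f (i, finRotate k j)) else 0

/-- Weight of the Hamiltonian cycle represented by the vertex ordering `g : Fin n ≃ Fin n`. -/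
noncomputable def hamW {n : ℕ} (w : Fin n → Fin n → ℝ) (g : Fin n ≃ Fin n) : ℝ :=
  ∑ j : Fin n, w (g j) (g (finRotate n j))

/-- `w̃` of a `k`-path packing: the total weight of the odd-position edges
`(v_{i1},v_{i2}), (v_{i3},v_{i4}), …` of each path. -/
noncomputable def tildeW {n m k : ℕ} (w : Fin n → Fin n → ℝ) (f : Fin m × Fin k ≃ Fin n) : ℝ :=
  ∑ i : Fin m, ∑ j : Fin k,
    if (j : ℕ) % 2 = 0 then w (f (i, j)) (f (i, finRotate k j)) else 0

/-- Weight of a matching of size `p`, given by the endpoints `x (i,0)`, `x (i,1)` of each edge. -/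
noncomputable def matchW {n p : ℕ} (w : Fin n → Fin n → ℝ) (x : Fin p × Fin 2 → Fin n) : ℝ :=
  ∑ i : Fin p, w (x (i, 0)) (x (i, 1))

theorem val_finRotate_eq_mod {n : ℕ} (x : Fin n) : (finRotate n x : ℕ) = (x + 1) % n := by
  cases n with
  | zero => exact x.elim0
  | succ n => simp [Fin.val_add]

theorem finRotate_finProdFinEquiv_castSucc {m k : ℕ} (i : Fin (m + 1)) (j : Fin k) :
    finRotate _ (finProdFinEquiv (i, j.castSucc)) = finProdFinEquiv (i, j.succ) := by
  ext
  rw [val_finRotate_eq_mod]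
  have h := (finProdFinEquiv (i, j.succ)).isLt
  simp only [finProdFinEquiv_apply_val, Fin.val_succ, Fin.val_castSucc] at h ⊢
  rw [Nat.mod_eq_of_lt (by omega)]
  omega

theorem finRotate_finProdFinEquiv_last {m k : ℕ} (i : Fin (m + 1)) :
    finRotate _ (finProdFinEquiv (i, Fin.last k)) = finProdFinEquiv (finRotate _ i, 0) := by
  ext
  rw [val_finRotate_eq_mod]
  simp only [finProdFinEquiv_apply_val, Fin.val_last, Fin.val_zero, val_finRotate_eq_mod]
  rw [show k + (k + 1) * (i : ℕ) + 1 = (k + 1) * (i + 1) by ring, Nat.mul_comm (m + 1),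
    Nat.mul_mod_mul_left, zero_add]

/-- Traversing the blocks of `F` one after the other gives a Hamiltonian cycle, made of the block
paths and of the edges joining consecutive blocks. -/
theorem hamW_finProdFinEquiv_symm_trans {m k : ℕ}
    (w : Fin ((m + 1) * (k + 1)) → Fin ((m + 1) * (k + 1)) → ℝ)
    (F : Fin (m + 1) × Fin (k + 1) ≃ Fin ((m + 1) * (k + 1))) :
    hamW w (finProdFinEquiv.symm.trans F) =
      ∑ i, (∑ j : Fin k, w (F (i, j.castSucc)) (F (i, j.succ)) +
        w (F (i, Fin.last k)) (F (finRotate _ i, 0))) := by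
  unfold hamW
  rw [← Equiv.sum_comp finProdFinEquiv, Fintype.sum_prod_type]
  refine Finset.sum_congr rfl fun i _ => ?_
  rw [Fin.sum_univ_castSucc, finRotate_finProdFinEquiv_last]
  simp only [finRotate_finProdFinEquiv_castSucc, Equiv.trans_apply, Equiv.symm_apply_apply]

theorem sum_finRotate_eq_path_add {V : Type*} {k : ℕ} (w : V → V → ℝ) (c : Fin (k + 1) → V) :
    ∑ j, w (c j) (c (finRotate _ j)) =
      ∑ j : Fin k, w (c j.castSucc) (c j.succ) + w (c (Fin.last k)) (c 0) := by
  rw [Fin.sum_univ_castSucc, finRotate_last]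
  simp only [finRotate_apply, Fin.coeSucc_eq_succ]

/-- The identity or the reversal of `Fin k`. -/
def orient (k : ℕ) (b : Bool) : Equiv.Perm (Fin k) := if b then 1 else Fin.revPerm

theorem sum_path_orient {V : Type*} {k : ℕ} (w : V → V → ℝ) (hsymm : ∀ u v, w u v = w v u)
    (c : Fin (k + 1) → V) (b : Bool) :
    ∑ j : Fin k, w (c (orient _ b j.castSucc)) (c (orient _ b j.succ)) =
      ∑ j : Fin k, w (c j.castSucc) (c j.succ) := by
  cases b
  · rw [← Equiv.sum_comp Fin.revPerm]
    refine Finset.sum_congr rfl fun j _ => ?_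
    rw [hsymm]
    simp [orient, Fin.rev_castSucc, Fin.rev_succ]
  · simp [orient]

theorem sum_bool_update_not {ι : Type*} [Fintype ι] [DecidableEq ι] (i : ι)
    (f : (ι → Bool) → ℝ) :
    ∑ σ : ι → Bool, f (Function.update σ i (!σ i)) = ∑ σ, f σ := by
  have h : Function.Involutive fun σ : ι → Bool => Function.update σ i (!σ i) := by
    intro σ
    simp
  exact Equiv.sum_comp h.toPerm f

/-- Over all orientations of the paths, the edge leaving path `i` towards a different path `i'`
has on average at least half the weight of the edge closing path `i`. -/
theorem card_mul_le_two_mul_sum_joining {V ι : Type*} [Fintype ι] [DecidableEq ι] {k : ℕ}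
    (w : V → V → ℝ) (hsymm : ∀ u v, w u v = w v u) (htri : ∀ u x v, w u v ≤ w u x + w x v)
    (c : ι × Fin (k + 1) → V) {i i' : ι} (hi : i' ≠ i) :
    Fintype.card (ι → Bool) * w (c (i, Fin.last k)) (c (i, 0)) ≤
      2 * ∑ σ : ι → Bool, w (c (i, orient _ (σ i) (Fin.last k))) (c (i', orient _ (σ i') 0)) := by
  rw [two_mul]
  nth_rewrite 1 [← sum_bool_update_not i]
  rw [← Finset.sum_add_distrib, ← nsmul_eq_mul, ← Finset.card_univ]
  refine Finset.card_nsmul_le_sum _ _ _ fun σ _ => ?_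
  simp only [Function.update_self, Function.update_of_ne hi]
  have key := fun x => htri (c (i, Fin.last k)) x (c (i, 0))
  cases σ i
  · simpa [orient, hsymm _ (c (i, 0))] using key (c (i', orient _ (σ i') 0))
  · simpa [orient, hsymm _ (c (i, 0)), add_comm] using key (c (i', orient _ (σ i') 0))

/-- Each cycle can be rotated so that its closing edge has at most average weight. -/
theorem exists_rotate_closing_edge_le {V : Type*} {k : ℕ} (w : V → V → ℝ) (c : Fin (k + 1) → V) :
    ∃ π : Equiv.Perm (Fin (k + 1)),
      (k + 1) * w (c (π (Fin.last k))) (c (π 0)) ≤ ∑ j, w (c j) (c (finRotate _ j)) ∧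
      ∑ j, w (c (π j)) (c (π (finRotate _ j))) = ∑ j, w (c j) (c (finRotate _ j)) := by
  obtain ⟨s, -, hs⟩ := Finset.exists_min_image Finset.univ
    (fun j => w (c j) (c (finRotate _ j))) Finset.univ_nonempty
  refine ⟨Equiv.addLeft (s + 1), ?_, ?_⟩
  · have h := Finset.card_nsmul_le_sum Finset.univ _ _ hs
    have hl : s + 1 + Fin.last k = s := by
      rw [add_assoc, add_comm 1, Fin.last_add_one, add_zero]
    rw [Finset.card_univ, Fintype.card_fin, nsmul_eq_mul] at h
    simpa only [Equiv.coe_addLeft, hl, add_zero, finRotate_apply, Nat.cast_add_one] using h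
  · rw [← Equiv.sum_comp (Equiv.addLeft (s + 1)) fun j => w (c j) (c (finRotate _ j))]
    simp only [finRotate_apply, Equiv.coe_addLeft, add_assoc]

/-- In a metric complete graph on `n = m * k` vertices (`k ≥ 3`), the maximum
weight `H*` of a Hamiltonian cycle satisfies `w(H*) ≥ (1 - 1/(2k)) · w(C*_k)`, where `C*_k` is
a maximum-weight `k`-cycle packing. -/
theorem stmt0 (n k m : ℕ) (hk : 3 ≤ k) (hn : n = m * k)
    (w : Fin n → Fin n → ℝ)
    (hnonneg : ∀ u v, 0 ≤ w u v) (hsymm : ∀ u v, w u v = w v u)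
    (htri : ∀ u x v, w u v ≤ w u x + w x v)
    (Hstar : Fin n ≃ Fin n)
    (hHmax : ∀ g : Fin n ≃ Fin n, hamW w g ≤ hamW w Hstar)
    (Cstar : Fin m × Fin k ≃ Fin n)
    (hCmax : ∀ C : Fin m × Fin k ≃ Fin n, cycleW w C ≤ cycleW w Cstar) :
    hamW w Hstar ≥ (1 - 1 / (2 * (k : ℝ))) * cycleW w Cstar := by
  subst hn
  obtain ⟨k, rfl⟩ : ∃ l, k = l + 1 := ⟨k - 1, by omega⟩
  obtain _ | m := m
  · have hH : hamW w Hstar = 0 :=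
      Finset.sum_eq_zero fun j _ => (j.cast (Nat.zero_mul _)).elim0
    simp [hH, cycleW]
  have hcard : (0 : ℝ) < Fintype.card (Fin (m + 1) → Bool) := by exact_mod_cast Fintype.card_pos
  choose π hle hrot using fun i => exists_rotate_closing_edge_le w fun j => Cstar (i, j)
  set P : Fin (m + 1) → ℝ := fun i =>
    ∑ j : Fin k, w (Cstar (i, π i j.castSucc)) (Cstar (i, π i j.succ)) with hP
  set e : Fin (m + 1) → ℝ := fun i =>
    w (Cstar (i, π i (Fin.last k))) (Cstar (i, π i 0)) with he
  have hC : cycleW w Cstar = ∑ i, P i + ∑ i, e i := by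
    rw [← Finset.sum_add_distrib]
    refine Finset.sum_congr rfl fun i _ => ?_
    rw [← hrot i]
    exact sum_finRotate_eq_path_add w fun j => Cstar (i, π i j)
  have hE : (k + 1) * ∑ i, e i ≤ cycleW w Cstar := by
    rw [Finset.mul_sum]
    exact Finset.sum_le_sum fun i _ => hle i
  have hham : ∑ i, P i + (∑ i, e i) / 2 ≤ hamW w Hstar := by
    obtain _ | m := m
    · have h := hHmax (finProdFinEquiv.symm.trans ((Equiv.prodCongrRight π).trans Cstar))
      rw [hamW_finProdFinEquiv_symm_trans] at h
      simp [hP, he] at h ⊢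
      linarith [hnonneg (Cstar (0, π 0 (Fin.last k))) (Cstar (0, π 0 0))]
    let J : (Fin (m + 2) → Bool) → Fin (m + 2) → ℝ := fun σ i =>
      w (Cstar (i, π i (orient _ (σ i) (Fin.last k))))
        (Cstar (finRotate _ i, π (finRotate _ i) (orient _ (σ (finRotate _ i)) 0)))
    have hσ : ∀ σ, ∑ i, P i + ∑ i, J σ i ≤ hamW w Hstar := by
      intro σ
      have h := hHmax (finProdFinEquiv.symm.trans
        ((Equiv.prodCongrRight fun i => (orient _ (σ i)).trans (π i)).trans Cstar))
      rw [hamW_finProdFinEquiv_symm_trans, Finset.sum_add_distrib] at h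
      refine le_of_eq_of_le ?_ h
      congr 1
      exact Finset.sum_congr rfl fun i _ =>
        (sum_path_orient w hsymm (fun j => Cstar (i, π i j)) (σ i)).symm
    have hsum := Finset.sum_le_sum fun σ (_ : σ ∈ Finset.univ) => hσ σ
    rw [Finset.sum_add_distrib, Finset.sum_const, Finset.sum_const,
      Finset.card_univ, nsmul_eq_mul, nsmul_eq_mul] at hsum
    have hjoin : Fintype.card (Fin (m + 2) → Bool) * ∑ i, e i ≤ 2 * ∑ σ, ∑ i, J σ i := by
      rw [Finset.sum_comm, Finset.mul_sum, Finset.mul_sum]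
      exact Finset.sum_le_sum fun i _ => card_mul_le_two_mul_sum_joining w hsymm htri
        (fun p : Fin (m + 2) × Fin (k + 1) => Cstar (p.1, π p.1 p.2))
        (show finRotate (m + 2) i ≠ i by simp)
    refine le_of_mul_le_mul_left ?_ hcard
    linarith
  have hk0 : (0 : ℝ) < k + 1 := by positivity
  have hE' : ∑ i, e i ≤ cycleW w Cstar / (k + 1) := by
    rw [le_div_iff₀ hk0]
    linarith
  have : (1 - 1 / (2 * ((k + 1 : ℕ) : ℝ))) * cycleW w Cstar =
      cycleW w Cstar - cycleW w Cstar / (k + 1) / 2 := by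
    push_cast
    field_simp
  rw [this]
  linarith
end

section
/- Let G be a metric complete graph on n vertices where k is even, k ≥ 4, and k divides n. For any k-path packing P_k of G there exists a k-cycle packing C_k of G (each cycle on the same vertex set as the corresponding path) with w(C_k) ≥ ((k-2)·w(P_k) + 2·w̃(P_k)) / (k-1). -/
open Finset

/-- The involution of `Fin (K + 1)` fixing `0, …, t` and reversing `t + 1, …, K`. -/
def reverseTail (K t : ℕ) : Equiv.Perm (Fin (K + 1)) :=
  Function.Involutive.toPerm
    (fun j => if h : (j : ℕ) ≤ t then j else ⟨K + 1 + t - j, by omega⟩) (by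
      intro j
      ext
      have := j.isLt
      simp only
      split_ifs with h₁ h₂ <;> simp_all <;> omega)

theorem reverseTail_val (K t : ℕ) (j : Fin (K + 1)) :
    (reverseTail K t j : ℕ) = if (j : ℕ) ≤ t then (j : ℕ) else K + 1 + t - j := by
  change ((if h : (j : ℕ) ≤ t then j else ⟨K + 1 + t - j, by omega⟩ : Fin (K + 1)) : ℕ) = _
  split_ifs <;> rfl

theorem finRotate_eq_ofNat {K : ℕ} (j : Fin (K + 1)) :
    finRotate (K + 1) j = Fin.ofNat (K + 1) (j + 1) := by
  ext
  simp [Fin.val_add]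

theorem sum_finRotate {α : Type*} {K : ℕ} (w : α → α → ℝ) (v : Fin (K + 1) → α) :
    ∑ j, w (v j) (v (finRotate (K + 1) j)) =
      ∑ j : Fin K, w (v j.castSucc) (v j.succ) + w (v (Fin.last K)) (v 0) := by
  rw [Fin.sum_univ_castSucc]
  simp

theorem sum_range_two_mul (g : ℕ → ℝ) (p : ℕ) :
    ∑ t ∈ range (2 * p), g t = ∑ i ∈ range p, (g (2 * i) + g (2 * i + 1)) := by
  induction p with
  | zero => simp
  | succ p ih => rw [Nat.mul_succ, sum_range_succ, sum_range_succ, ih, sum_range_succ, add_assoc]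

/-- The cycle obtained from the path `u 0, …, u K` by reversing everything after `u t`. -/
theorem cycle_reverseTail {α : Type*} {w : α → α → ℝ} (hsymm : ∀ a b, w a b = w b a)
    (u : ℕ → α) {K t : ℕ} (ht : t < K) :
    ∑ j, w (u (reverseTail K t j)) (u (reverseTail K t (finRotate (K + 1) j))) =
      ∑ j ∈ range K, w (u j) (u (j + 1)) - w (u t) (u (t + 1)) + w (u t) (u K) +
        w (u 0) (u (t + 1)) := by
  obtain ⟨d, rfl⟩ : ∃ d, K = t + 1 + d := ⟨K - (t + 1), by omega⟩
  rw [sum_finRotate w fun j => u (reverseTail (t + 1 + d) t j)]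
  simp only [reverseTail_val, Fin.val_castSucc, Fin.val_succ, Fin.val_last]
  rw [if_pos (show ((0 : Fin (t + 1 + d + 1)) : ℕ) ≤ t by simp), Fin.val_zero]
  rw [Fin.sum_univ_eq_sum_range fun j =>
      w (u (if j ≤ t then j else t + 1 + d + 1 + t - j))
        (u (if j + 1 ≤ t then j + 1 else t + 1 + d + 1 + t - (j + 1))),
    sum_range_add _ (t + 1) d, sum_range_add _ (t + 1) d, sum_range_succ _ t, sum_range_succ _ t]
  have hhead : ∑ j ∈ range t, w (u (if j ≤ t then j else t + 1 + d + 1 + t - j))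
      (u (if j + 1 ≤ t then j + 1 else t + 1 + d + 1 + t - (j + 1))) =
      ∑ j ∈ range t, w (u j) (u (j + 1)) := by
    refine sum_congr rfl fun j hj => ?_
    have := mem_range.1 hj
    rw [if_pos (by omega), if_pos (by omega)]
  have htail : ∑ j ∈ range d, w (u (if t + 1 + j ≤ t then t + 1 + j
        else t + 1 + d + 1 + t - (t + 1 + j)))
      (u (if t + 1 + j + 1 ≤ t then t + 1 + j + 1
        else t + 1 + d + 1 + t - (t + 1 + j + 1))) =
      ∑ j ∈ range d, w (u (t + 1 + j)) (u (t + 1 + j + 1)) := by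
    rw [← sum_range_reflect]
    refine sum_congr rfl fun j hj => ?_
    have := mem_range.1 hj
    rw [if_neg (by omega), if_neg (by omega), hsymm]
    congr 2 <;> omega
  rw [hhead, htail, if_pos le_rfl, if_neg (by omega), if_neg (by omega),
    hsymm (u 0), show t + 1 + d + 1 + t - (t + 1) = t + 1 + d by omega,
    show t + 1 + d + 1 + t - (t + 1 + d) = t + 1 by omega]
  ring

/-- Averaging over the cut position `t` yields a heavy cycle on the vertices of a path with an
even number of vertices. -/
theorem exists_heavy_cycle {α : Type*} {w : α → α → ℝ} (hsymm : ∀ a b, w a b = w b a)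
    (htri : ∀ a x b, w a b ≤ w a x + w x b) (u : ℕ → α) (p : ℕ) :
    ∃ σ : Equiv.Perm (Fin (2 * p + 1 + 1)),
      2 * (p : ℝ) * ∑ j ∈ range (2 * p + 1), w (u j) (u (j + 1)) +
          2 * ∑ i ∈ range (p + 1), w (u (2 * i)) (u (2 * i + 1)) ≤
        (2 * (p : ℝ) + 1) * ∑ j, w (u (σ j)) (u (σ (finRotate (2 * p + 1 + 1) j))) := by
  set S := ∑ j ∈ range (2 * p + 1), w (u j) (u (j + 1)) with hS
  set T := ∑ i ∈ range (p + 1), w (u (2 * i)) (u (2 * i + 1)) with hT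
  have hlast : T ≤ ∑ t ∈ range (2 * p + 1), w (u t) (u (2 * p + 1)) := by
    rw [hT, sum_range_succ, sum_range_succ, sum_range_two_mul]
    gcongr with i
    rw [hsymm (u (2 * i + 1)) (u (2 * p + 1))]
    exact htri _ _ _
  have hfirst : T ≤ ∑ t ∈ range (2 * p + 1), w (u 0) (u (t + 1)) := by
    rw [hT, sum_range_succ', sum_range_succ', sum_range_two_mul]
    gcongr with i
    rw [hsymm (u 0) (u (2 * i + 1 + 1))]
    exact htri _ _ _
  by_contra! hlt
  have hsum : ∑ t ∈ range (2 * p + 1), (2 * (p : ℝ) + 1) *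
      (S - w (u t) (u (t + 1)) + w (u t) (u (2 * p + 1)) + w (u 0) (u (t + 1))) <
      ∑ _t ∈ range (2 * p + 1), (2 * (p : ℝ) * S + 2 * T) := by
    refine sum_lt_sum_of_nonempty (by simp) fun t ht => ?_
    rw [hS, ← cycle_reverseTail hsymm u (mem_range.1 ht)]
    exact hlt _
  rw [← mul_sum, sum_add_distrib, sum_add_distrib, sum_sub_distrib, ← hS] at hsum
  simp only [sum_const, card_range, nsmul_eq_mul] at hsum
  push_cast at hsum
  have := lt_of_mul_lt_mul_left hsum (by positivity)
  linarith

/-- In a metric complete graph on `n = m * k` vertices with `k` even, `k ≥ 4`,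
for any `k`-path packing `P_k` there is a `k`-cycle packing `C_k`, each cycle on the same
vertex set as the corresponding path, with
`w(C_k) ≥ ((k-2)·w(P_k) + 2·w̃(P_k)) / (k-1)`. -/
theorem stmt2 (n k m : ℕ) (hkeven : Even k) (hk : 4 ≤ k) (hn : n = m * k)
    (w : Fin n → Fin n → ℝ)
    (hnonneg : ∀ u v, 0 ≤ w u v) (hsymm : ∀ u v, w u v = w v u)
    (htri : ∀ u x v, w u v ≤ w u x + w x v)
    (P : Fin m × Fin k ≃ Fin n) :
    ∃ C : Fin m × Fin k ≃ Fin n,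
      (∀ i : Fin m,
        (Set.range fun j : Fin k => C (i, j)) = Set.range fun j : Fin k => P (i, j)) ∧
      cycleW w C ≥ (((k : ℝ) - 2) * pathW w P + 2 * tildeW w P) / ((k : ℝ) - 1) := by
  obtain ⟨p, rfl⟩ : ∃ p, k = 2 * p + 1 + 1 := by
    obtain ⟨r, rfl⟩ := hkeven
    exact ⟨r - 1, by omega⟩
  choose σ hσ using fun i : Fin m =>
    exists_heavy_cycle hsymm htri (fun a => P (i, Fin.ofNat (2 * p + 1 + 1) a)) p
  refine ⟨(Equiv.prodCongrRight σ).trans P, fun i => ?_, ?_⟩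
  · exact (σ i).surjective.range_comp fun j => P (i, j)
  have hpath : pathW w P = ∑ i, ∑ j ∈ range (2 * p + 1),
      w (P (i, Fin.ofNat (2 * p + 1 + 1) j)) (P (i, Fin.ofNat (2 * p + 1 + 1) (j + 1))) := by
    refine sum_congr rfl fun i _ => ?_
    have hsum := Fin.sum_univ_eq_sum_range (fun j => if j + 1 < 2 * p + 1 + 1 then
      w (P (i, Fin.ofNat (2 * p + 1 + 1) j)) (P (i, Fin.ofNat (2 * p + 1 + 1) (j + 1))) else 0)
      (2 * p + 1 + 1)
    simp only [finRotate_eq_ofNat]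
    simp only [Fin.ofNat_val_eq_self] at hsum
    rw [hsum, sum_range_succ, if_neg (lt_irrefl _), add_zero]
    exact sum_congr rfl fun j hj => if_pos (Nat.succ_lt_succ (mem_range.1 hj))
  have htilde : tildeW w P = ∑ i, ∑ j ∈ range (p + 1),
      w (P (i, Fin.ofNat (2 * p + 1 + 1) (2 * j)))
        (P (i, Fin.ofNat (2 * p + 1 + 1) (2 * j + 1))) := by
    refine sum_congr rfl fun i _ => ?_
    have hsum := (Fin.sum_univ_eq_sum_range (fun j => if j % 2 = 0 then
      w (P (i, Fin.ofNat (2 * p + 1 + 1) j)) (P (i, Fin.ofNat (2 * p + 1 + 1) (j + 1))) else 0)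
      (2 * p + 1 + 1)).trans (sum_range_two_mul _ (p + 1))
    simp only [finRotate_eq_ofNat]
    simp only [Fin.ofNat_val_eq_self] at hsum
    rw [hsum]
    refine sum_congr rfl fun j _ => ?_
    rw [if_pos (by omega), if_neg (by omega), add_zero]
  have hcycle : cycleW w ((Equiv.prodCongrRight σ).trans P) = ∑ i, ∑ j,
      w (P (i, Fin.ofNat (2 * p + 1 + 1) (σ i j)))
        (P (i, Fin.ofNat (2 * p + 1 + 1) (σ i (finRotate (2 * p + 1 + 1) j)))) := by
    simp [cycleW]
  have hp : (0 : ℝ) < 2 * p + 1 := by positivity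
  rw [ge_iff_le, show ((2 * p + 1 + 1 : ℕ) : ℝ) - 1 = 2 * p + 1 by push_cast; ring,
    show ((2 * p + 1 + 1 : ℕ) : ℝ) - 2 = 2 * p by push_cast; ring, div_le_iff₀' hp,
    hpath, htilde, hcycle, mul_sum, mul_sum, mul_sum, ← sum_add_distrib]
  exact sum_le_sum fun i _ => hσ i
end

section
/- Let G be a metric complete graph on n vertices where k is even, k ≥ 4, and k divides n, and let H be any Hamiltonian cycle in G. Then there exists a k-cycle packing C_k of G with w(C_k) ≥ (1 - 1/k + 1/(k(k-1)))·w(H). -/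
open Finset

/-- Total weight of the chords `{v (x + a), v (x + b)}` of the cyclic sequence `v`. -/
noncomputable def chordW {n : ℕ} [NeZero n] (w : Fin n → Fin n → ℝ) (v : Fin n ≃ Fin n)
    (a b : ℕ) : ℝ :=
  ∑ x : Fin n, w (v (x + Fin.ofNat n a)) (v (x + Fin.ofNat n b))

lemma Fin.ofNat_add_ofNat (n a b : ℕ) [NeZero n] :
    Fin.ofNat n a + Fin.ofNat n b = Fin.ofNat n (a + b) := by
  ext
  simp [Fin.val_add]

lemma chordW_comm {n : ℕ} [NeZero n] {w : Fin n → Fin n → ℝ} (hsymm : ∀ u v, w u v = w v u)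
    (v : Fin n ≃ Fin n) (a b : ℕ) : chordW w v a b = chordW w v b a :=
  Finset.sum_congr rfl fun _ _ => hsymm _ _

lemma chordW_add_left {n : ℕ} [NeZero n] (w : Fin n → Fin n → ℝ) (v : Fin n ≃ Fin n)
    (a b c : ℕ) : chordW w v (c + a) (c + b) = chordW w v a b := by
  unfold chordW
  rw [← Equiv.sum_comp (Equiv.addRight (Fin.ofNat n c))
    (fun x => w (v (x + Fin.ofNat n a)) (v (x + Fin.ofNat n b)))]
  simp only [Equiv.coe_addRight, add_assoc, Fin.ofNat_add_ofNat]

lemma chordW_triangle {n : ℕ} [NeZero n] {w : Fin n → Fin n → ℝ}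
    (htri : ∀ u x v, w u v ≤ w u x + w x v) (v : Fin n ≃ Fin n) (a b c : ℕ) :
    chordW w v a c ≤ chordW w v a b + chordW w v b c := by
  unfold chordW
  rw [← Finset.sum_add_distrib]
  exact Finset.sum_le_sum fun _ _ => htri _ _ _

lemma hamW_eq_chordW {n : ℕ} [NeZero n] (w : Fin n → Fin n → ℝ) (v : Fin n ≃ Fin n) :
    hamW w v = chordW w v 0 1 := by
  unfold hamW chordW
  refine Finset.sum_congr rfl fun x _ => ?_
  have h0 : Fin.ofNat n 0 = 0 := by ext; simp
  have h1 : Fin.ofNat n 1 = 1 := rfl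
  rw [finRotate_apply, h0, h1, add_zero]

/-- Cut the cyclic sequence `v` into consecutive blocks of length `k`, starting at position `s`,
and traverse every block in the order given by `σ`. -/
def blockPacking {m k : ℕ} [NeZero (m * k)] (v : Fin (m * k) ≃ Fin (m * k))
    (σ : Equiv.Perm (Fin k)) (s : Fin (m * k)) : Fin m × Fin k ≃ Fin (m * k) :=
  (((Equiv.refl (Fin m)).prodCongr σ).trans finProdFinEquiv).trans ((Equiv.addLeft s).trans v)

lemma sum_cycleW_blockPacking {m k : ℕ} [NeZero (m * k)] (w : Fin (m * k) → Fin (m * k) → ℝ)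
    (v : Fin (m * k) ≃ Fin (m * k)) (σ : Equiv.Perm (Fin k)) :
    ∑ s, cycleW w (blockPacking v σ s) =
      m * ∑ j : Fin k, chordW w v (σ j) (σ (finRotate k j)) := by
  have key (i : Fin m) (a : Fin k) (s : Fin (m * k)) :
      s + finProdFinEquiv (i, a) = s + Fin.ofNat (m * k) (k * i + a) := by
    congr 1
    ext
    have := (finProdFinEquiv (i, a)).isLt
    simp only [finProdFinEquiv_apply_val] at this
    simp only [finProdFinEquiv_apply_val, Fin.val_ofNat]
    rw [add_comm (k * (i : ℕ)), Nat.mod_eq_of_lt this]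
  unfold cycleW
  rw [Finset.sum_comm]
  calc _ = ∑ i : Fin m, ∑ j : Fin k, chordW w v (σ j) (σ (finRotate k j)) := by
        refine Finset.sum_congr rfl fun i _ => ?_
        rw [Finset.sum_comm]
        refine Finset.sum_congr rfl fun j _ => ?_
        rw [← chordW_add_left w v _ _ (k * i)]
        refine Finset.sum_congr rfl fun s _ => ?_
        simp only [← key]
        rfl
    _ = _ := by simp

/-- By averaging over the starting position, some block packing is at least as heavy as average. -/
lemma exists_cycleW_ge {m k : ℕ} [NeZero (m * k)] (w : Fin (m * k) → Fin (m * k) → ℝ)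
    (v : Fin (m * k) ≃ Fin (m * k)) (σ : Equiv.Perm (Fin k)) :
    ∃ C : Fin m × Fin k ≃ Fin (m * k),
      ∑ j : Fin k, chordW w v (σ j) (σ (finRotate k j)) ≤ k * cycleW w C := by
  by_contra! h
  have hlt : ∑ s, k * cycleW w (blockPacking v σ s) <
      ∑ _s : Fin (m * k), ∑ j : Fin k, chordW w v (σ j) (σ (finRotate k j)) :=
    Finset.sum_lt_sum_of_nonempty ⟨0, Finset.mem_univ _⟩ fun s _ => h _
  rw [← Finset.mul_sum, sum_cycleW_blockPacking] at hlt
  simp only [Finset.sum_const, Finset.card_univ, Fintype.card_fin, nsmul_eq_mul,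
    Nat.cast_mul] at hlt
  linarith

lemma sum_finRotate_s3 {K : ℕ} (F : Fin (K + 1) → Fin (K + 1) → ℝ) :
    ∑ j, F j (finRotate (K + 1) j) =
      ∑ p : Fin K, F p.castSucc p.succ + F (Fin.last K) 0 := by
  rw [Fin.sum_univ_castSucc, finRotate_last]
  congr 1
  refine Finset.sum_congr rfl fun p _ => ?_
  rw [finRotate_apply, Fin.coeSucc_eq_succ]

/-- Traversing a block in its given order. -/
lemma sum_chordW_id {n K : ℕ} [NeZero n] {w : Fin n → Fin n → ℝ}
    (hsymm : ∀ u v, w u v = w v u) (v : Fin n ≃ Fin n) :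
    ∑ j : Fin (K + 1), chordW w v j (finRotate (K + 1) j) =
      K * chordW w v 0 1 + chordW w v 0 K := by
  rw [sum_finRotate_s3 (fun a b => chordW w v a b)]
  have (p : Fin K) : chordW w v p.castSucc p.succ = chordW w v 0 1 :=
    chordW_add_left w v 0 1 p
  simp only [this, Finset.sum_const, Finset.card_univ, Fintype.card_fin, nsmul_eq_mul,
    Fin.val_last, Fin.val_zero, chordW_comm hsymm v K 0]

/-- Traversing a block in the order `1, …, j, 0, j + 1, …, K`. -/
lemma sum_chordW_cycleRange {n K : ℕ} [NeZero n] {w : Fin n → Fin n → ℝ}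
    (hsymm : ∀ u v, w u v = w v u) (v : Fin n ≃ Fin n) (j : Fin (K + 1)) (hj0 : 0 < (j : ℕ))
    (hj : (j : ℕ) < K) :
    ∑ i : Fin (K + 1), chordW w v (j.cycleRange i) (j.cycleRange (finRotate (K + 1) i)) =
      (K - 2) * chordW w v 0 1 + chordW w v 0 (K - 1 : ℕ) + chordW w v 0 j +
        chordW w v 0 (j + 1) := by
  rw [sum_finRotate_s3 (fun a b => chordW w v (j.cycleRange a) (j.cycleRange b))]
  have hval (i : Fin (K + 1)) : (j.cycleRange i : ℕ) =
      if (i : ℕ) < j then (i : ℕ) + 1 else if (i : ℕ) = j then 0 else i := by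
    split_ifs with h1 h2
    · exact Fin.coe_cycleRange_of_lt h1
    · rw [Fin.cycleRange_of_eq (Fin.ext h2)]; rfl
    · rw [Fin.cycleRange_of_gt (Fin.lt_def.2 (by omega))]
  have hterm (p : Fin K) :
      chordW w v (j.cycleRange p.castSucc) (j.cycleRange p.succ) =
        chordW w v 0 1 + (if p = ⟨j - 1, by omega⟩ then chordW w v 0 j - chordW w v 0 1 else 0) +
          (if p = ⟨j, hj⟩ then chordW w v 0 (j + 1) - chordW w v 0 1 else 0) := by
    simp only [hval, Fin.val_castSucc, Fin.val_succ, Fin.ext_iff]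
    rcases lt_trichotomy (p + 1 : ℕ) j with h | h | h
    · rw [if_pos (by omega), if_pos h, if_neg (by omega), if_neg (by omega)]
      have := chordW_add_left w v 0 1 (p + 1)
      simpa using this
    · rw [if_pos (by omega), if_neg (by omega), if_pos h, if_pos (by omega), if_neg (by omega), h,
        chordW_comm hsymm]
      ring
    · rw [if_neg (by omega : ¬ (p : ℕ) < j), if_neg (by omega : ¬ (p + 1 : ℕ) < j),
        if_neg (by omega : ¬ (p + 1 : ℕ) = j), if_neg (by omega : ¬ (p : ℕ) = j - 1)]
      split_ifs with h2
      · rw [h2]; ring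
      · have := chordW_add_left w v 0 1 p
        simpa using this
  have hlast : chordW w v (j.cycleRange (Fin.last K)) (j.cycleRange 0) =
      chordW w v 0 (K - 1 : ℕ) := by
    rw [hval, hval, Fin.val_last, if_neg (by omega), if_neg (by omega), Fin.val_zero, if_pos hj0,
      chordW_comm hsymm, ← chordW_add_left w v 0 (K - 1) 1, show 1 + (K - 1) = K by omega]
  simp only [hterm, hlast, Finset.sum_add_distrib, Finset.sum_ite_eq', Finset.mem_univ, if_true,
    Finset.sum_const, Finset.card_univ, Fintype.card_fin, nsmul_eq_mul]
  ring

lemma le_sum_consecutive_pairs {D : ℕ → ℝ} (hD : ∀ j, D 1 ≤ D j + D (j + 1)) (p : ℕ) :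
    (p + 1) * D 1 + D (2 * (p + 1)) ≤ ∑ r ∈ range (p + 1), (D (2 * r + 1) + D (2 * r + 2)) := by
  induction p with
  | zero => simp
  | succ p ih =>
    rw [Finset.sum_range_succ]
    have := hD (2 * (p + 1))
    push_cast
    rw [show 2 * (p + 1 + 1) = 2 * (p + 1) + 2 by ring]
    linarith

lemma exists_heavy_insertion {D : ℕ → ℝ} (hD : ∀ j, D 1 ≤ D j + D (j + 1)) {K q : ℕ}
    (hK : K = 2 * q + 3)
    (h : K * D 1 + D K < (K + 1 / K) * D 1) :
    ∃ j, 0 < j ∧ j < K ∧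
      (K + 1 / K) * D 1 ≤ (K - 2) * D 1 + D (K - 1) + D j + D (j + 1) := by
  by_contra! hcon
  have hsum := le_sum_consecutive_pairs hD q
  have hle : ∑ r ∈ range (q + 1), (D (2 * r + 1) + D (2 * r + 2)) ≤
      ∑ r ∈ range (q + 1), ((K + 1 / K) * D 1 - (K - 2) * D 1 - D (K - 1)) := by
    refine Finset.sum_le_sum fun r hr => ?_
    rw [Finset.mem_range] at hr
    have := hcon (2 * r + 1) (by omega) (by omega)
    rw [show 2 * r + 2 = 2 * r + 1 + 1 by ring]
    linarith
  rw [Finset.sum_const, Finset.card_range, nsmul_eq_mul] at hle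
  have h1 := hD (K - 1)
  rw [show K - 1 + 1 = K by omega] at h1
  rw [show 2 * (q + 1) = K - 1 by omega] at hsum
  have hKq : (K : ℝ) = 2 * q + 3 := by rw [hK]; push_cast; ring
  have hq : (0 : ℝ) ≤ q := Nat.cast_nonneg q
  have hx : (K : ℝ) * (1 / K * D 1) = D 1 := by
    rw [← mul_assoc, mul_one_div_cancel (by rw [hKq]; positivity), one_mul]
  push_cast at hle
  rw [add_mul (K : ℝ)] at h hle
  generalize (1 / (K : ℝ)) * D 1 = x at *
  have hP : 0 < (q + 2 : ℝ) * (D (K - 1) - D 1 + x) := mul_pos (by positivity) (by linarith)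
  rw [hKq] at hx hle
  linarith

/-- In a metric complete graph on `n = m * k` vertices with `k` even, `k ≥ 4`,
for any Hamiltonian cycle `H` there is a `k`-cycle packing `C_k` with
`w(C_k) ≥ (1 - 1/k + 1/(k(k-1))) · w(H)`. -/
theorem stmt3 (n k m : ℕ) (hkeven : Even k) (hk : 4 ≤ k) (hn : n = m * k)
    (w : Fin n → Fin n → ℝ)
    (hnonneg : ∀ u v, 0 ≤ w u v) (hsymm : ∀ u v, w u v = w v u)
    (htri : ∀ u x v, w u v ≤ w u x + w x v)
    (H : Fin n ≃ Fin n) :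
    ∃ C : Fin m × Fin k ≃ Fin n,
      cycleW w C ≥ (1 - 1 / (k : ℝ) + 1 / ((k : ℝ) * ((k : ℝ) - 1))) * hamW w H := by
  rcases Nat.eq_zero_or_pos m with rfl | hm
  · obtain rfl : n = 0 := by simpa using hn
    exact ⟨Equiv.equivOfIsEmpty _ _, by simp [cycleW, hamW]⟩
  subst hn
  have : NeZero (m * k) := ⟨by positivity⟩
  obtain ⟨q, rfl⟩ : ∃ q, k = 2 * q + 3 + 1 := by
    obtain ⟨r, rfl⟩ := hkeven
    exact ⟨r - 2, by omega⟩
  generalize hK : 2 * q + 3 = K at *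
  have hKpos : (0 : ℝ) < K := by
    rw [← hK]
    positivity
  suffices h : ∃ σ : Equiv.Perm (Fin (K + 1)), (K + 1 / K) * hamW w H ≤
      ∑ j, chordW w H (σ j) (σ (finRotate (K + 1) j)) by
    obtain ⟨σ, hσ⟩ := h
    obtain ⟨C, hC⟩ := exists_cycleW_ge w H σ
    refine ⟨C, ?_⟩
    have hcoef : (1 - 1 / ((K + 1 : ℕ) : ℝ) + 1 / (((K + 1 : ℕ) : ℝ) * (((K + 1 : ℕ) : ℝ) - 1))) *
        hamW w H = (K + 1 / K) * hamW w H / (K + 1 : ℕ) := by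
      push_cast
      rw [add_sub_cancel_right]
      field_simp
      ring
    rw [hcoef, ge_iff_le, div_le_iff₀ (by positivity), mul_comm (cycleW w C)]
    exact hσ.trans hC
  rw [hamW_eq_chordW]
  by_cases h : (K + 1 / K) * chordW w H 0 1 ≤ K * chordW w H 0 1 + chordW w H 0 K
  · exact ⟨1, h.trans_eq (sum_chordW_id hsymm H).symm⟩
  · have hD (j : ℕ) : chordW w H 0 1 ≤ chordW w H 0 j + chordW w H 0 (j + 1) := by
      have h1 := chordW_triangle htri H j 0 (j + 1)
      rw [chordW_comm hsymm H j 0] at h1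
      exact (chordW_add_left w H 0 1 j).symm.trans_le h1
    obtain ⟨j, hj0, hj, hle⟩ := exists_heavy_insertion hD hK.symm (not_le.1 h)
    exact ⟨(⟨j, by omega⟩ : Fin (K + 1)).cycleRange,
      hle.trans_eq (sum_chordW_cycleRange hsymm H ⟨j, by omega⟩ hj0 hj).symm⟩
end

section
/- Let G be a complete graph on n vertices with nonnegative edge weights. If k is even, k ≥ 4, and k divides n, then the maximum weight of a perfect matching satisfies w(M*) ≥ (1/2)·w(C*_k); moreover, if n is even then w(M*) ≥ (1/2)·w(H*), where H* is a maximum-weight Hamiltonian cycle. -/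
open Finset

theorem finRotate_finProdFinEquiv_zero {h : ℕ} (a : Fin h) :
    finRotate (h * 2) (finProdFinEquiv (a, (0 : Fin 2))) = finProdFinEquiv (a, (1 : Fin 2)) := by
  obtain ⟨N, hN⟩ : ∃ N, h * 2 = N + 1 := ⟨h * 2 - 1, by have := a.isLt; omega⟩
  have key : ∀ (L : ℕ), L = N + 1 → ∀ x y : Fin L, (x : ℕ) + 1 = y → finRotate L x = y := by
    rintro L rfl ⟨x, hx⟩ ⟨y, hy⟩ hxy
    simp only at hxy
    subst hxy
    exact finRotate_of_lt (by omega)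
  refine key _ hN _ _ ?_
  simp [add_comm]

/-- The consecutive pairs `(f (i, 2a), f (i, 2a + 1))` of a cycle packing form a perfect
matching. -/
theorem sum_consecutive_pairs_le {n m h p : ℕ} (w : Fin n → Fin n → ℝ) (hp : p = m * h) {B : ℝ}
    (hB : ∀ M : Fin p × Fin 2 ≃ Fin n, matchW w (fun q => M q) ≤ B)
    (f : Fin m × Fin (h * 2) ≃ Fin n) :
    ∑ i : Fin m, ∑ a : Fin h,
      w (f (i, finProdFinEquiv (a, (0 : Fin 2)))) (f (i, finProdFinEquiv (a, (1 : Fin 2)))) ≤ B := by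
  subst hp
  refine le_of_eq_of_le ?_ (hB ((((finProdFinEquiv.symm.prodCongr (Equiv.refl (Fin 2))).trans
    (Equiv.prodAssoc _ _ _)).trans ((Equiv.refl (Fin m)).prodCongr finProdFinEquiv)).trans f))
  rw [← Fintype.sum_prod_type', matchW, ← finProdFinEquiv.sum_comp]
  simp

theorem cycleW_le_two_mul {n m k p : ℕ} (w : Fin n → Fin n → ℝ) (hk : Even k)
    (hp : m * k = 2 * p) {B : ℝ}
    (hB : ∀ M : Fin p × Fin 2 ≃ Fin n, matchW w (fun q => M q) ≤ B)
    (f : Fin m × Fin k ≃ Fin n) : cycleW w f ≤ 2 * B := by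
  obtain ⟨h, rfl⟩ : ∃ h, k = h * 2 := hk.exists_two_nsmul.imp fun h e => by simpa [mul_comm] using e
  have hp' : p = m * h := by
    rw [← mul_assoc] at hp
    omega
  have h₁ := sum_consecutive_pairs_le w hp' hB f
  have h₂ := sum_consecutive_pairs_le w hp' hB
    (((Equiv.refl (Fin m)).prodCongr (finRotate (h * 2))).trans f)
  refine le_of_eq_of_le ?_ ((add_le_add h₁ h₂).trans_eq (two_mul B).symm)
  rw [← sum_add_distrib]
  refine sum_congr rfl fun i _ => ?_
  rw [← sum_add_distrib, ← finProdFinEquiv.sum_comp, Fintype.sum_prod_type]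
  refine sum_congr rfl fun a _ => ?_
  simp [-finRotate_apply, Fin.sum_univ_two, finRotate_finProdFinEquiv_zero]

theorem hamW_eq_cycleW {n : ℕ} (w : Fin n → Fin n → ℝ) (g : Fin n ≃ Fin n) :
    hamW w g = cycleW w ((Equiv.uniqueProd (Fin n) (Fin 1)).trans g) := by
  simp [hamW, cycleW]

/-- In a complete graph with nonnegative edge weights on `n = m * k` vertices
with `k` even, `k ≥ 4`, the maximum weight `M*` of a perfect matching satisfies
`w(M*) ≥ (1/2)·w(C*_k)`; moreover, since `n = 2p` is even, `w(M*) ≥ (1/2)·w(H*)` where `H*`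
is a maximum-weight Hamiltonian cycle. -/
theorem stmt4 (n k m p : ℕ) (hkeven : Even k) (hk : 4 ≤ k) (hn : n = m * k)
    (hp : n = 2 * p)
    (w : Fin n → Fin n → ℝ)
    (hnonneg : ∀ u v, 0 ≤ w u v) (hsymm : ∀ u v, w u v = w v u)
    (Mstar : Fin p × Fin 2 ≃ Fin n)
    (hMmax : ∀ M : Fin p × Fin 2 ≃ Fin n,
      matchW w (fun q => M q) ≤ matchW w (fun q => Mstar q))
    (Cstar : Fin m × Fin k ≃ Fin n)
    (hCmax : ∀ C : Fin m × Fin k ≃ Fin n, cycleW w C ≤ cycleW w Cstar)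
    (Hstar : Fin n ≃ Fin n)
    (hHmax : ∀ g : Fin n ≃ Fin n, hamW w g ≤ hamW w Hstar) :
    matchW w (fun q => Mstar q) ≥ (1 / 2) * cycleW w Cstar ∧
    matchW w (fun q => Mstar q) ≥ (1 / 2) * hamW w Hstar := by
  have hcycle := cycleW_le_two_mul w hkeven (hn.symm.trans hp) hMmax Cstar
  have hham := cycleW_le_two_mul w ⟨p, by omega⟩ (by omega) hMmax
    ((Equiv.uniqueProd (Fin n) (Fin 1)).trans Hstar)
  rw [← hamW_eq_cycleW] at hham
  constructor <;> linarith
end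

section
/- Let G be a metric complete graph on an even number n of vertices. Then there exists a Hamiltonian cycle H in G with w(H) ≥ (5/8)·w(C*) + (1/2)·w(M*), where C* is a maximum-weight cycle packing and M* is a maximum-weight perfect matching. -/
open Finset

/-- Pairwise weights satisfying the properties of a (pseudo)metric, except that self-weights may be
positive. -/
structure MetricWeight {α : Type*} (w : α → α → ℝ) : Prop where
  nonneg : ∀ u v, 0 ≤ w u v
  symm : ∀ u v, w u v = w v u
  tri : ∀ u x v, w u v ≤ w u x + w x v

/-- `Closes w l v`: paths whose pairs of ends are listed in `l` can be connected to a cycle by edges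
of total weight at least `v`. -/
inductive Closes {α : Type*} (w : α → α → ℝ) : List (α × α) → ℝ → Prop
  | nil : Closes w [] 0
  | close (a b : α) : Closes w [(a, b)] (w a b)
  | join (a b c d : α) (l : List (α × α)) (v : ℝ) :
      Closes w ((a, d) :: l) v → Closes w ((a, b) :: (c, d) :: l) (v + w b c)
  | swap (a b : α) (l : List (α × α)) (v : ℝ) :
      Closes w ((b, a) :: l) v → Closes w ((a, b) :: l) v
  | perm (l l' : List (α × α)) (v : ℝ) : l.Perm l' → Closes w l v → Closes w l' v
  | mono (l : List (α × α)) (v v' : ℝ) : v' ≤ v → Closes w l v → Closes w l v'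

section Blocks

open scoped BigOperators

variable {α : Type*} {w : α → α → ℝ}

theorem Closes.of_perm {l l' : List (α × α)} {v v' : ℝ} (h : Closes w l v) (hp : l.Perm l')
    (hv : v' ≤ v) : Closes w l' v' :=
  Closes.mono _ _ _ hv (Closes.perm _ _ _ hp h)

/-- Connecting some of the paths in `l` by edges of total weight `g` can give the paths in `l'`. -/
def Reach (w : α → α → ℝ) (l l' : List (α × α)) (g : ℝ) : Prop :=
  ∀ m v, Closes w (l' ++ m) v → Closes w (l ++ m) (v + g)

theorem Reach.refl (l : List (α × α)) : Reach w l l 0 := fun m v h => by simpa using h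

theorem Reach.trans {l l' l'' : List (α × α)} {g g' : ℝ} (h : Reach w l l' g)
    (h' : Reach w l' l'' g') : Reach w l l'' (g + g') := fun m v hv =>
  (h _ _ (h' _ _ hv)).mono _ _ _ (by linarith)

theorem Reach.perm {l l' : List (α × α)} (h : l.Perm l') : Reach w l l' 0 := fun m v hv =>
  hv.of_perm (h.symm.append_right m) (by simp)

theorem Reach.mono {l l' : List (α × α)} {g g' : ℝ} (h : Reach w l l' g) (hg : g' ≤ g) :
    Reach w l l' g' := fun m v hv => (h _ _ hv).mono _ _ _ (by linarith)

theorem Reach.append_right {l l' : List (α × α)} {g : ℝ} (h : Reach w l l' g)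
    (k : List (α × α)) : Reach w (l ++ k) (l' ++ k) g := fun m v hv => by
  rw [List.append_assoc] at hv ⊢
  exact h _ _ hv

theorem Reach.append_left {l l' : List (α × α)} {g : ℝ} (h : Reach w l l' g)
    (k : List (α × α)) : Reach w (k ++ l) (k ++ l') g :=
  (((Reach.perm List.perm_append_comm).trans (h.append_right k)).trans
    (Reach.perm List.perm_append_comm)).mono (by simp)

theorem Reach.append {l l' k k' : List (α × α)} {g g' : ℝ} (h : Reach w l l' g)
    (h' : Reach w k k' g') : Reach w (l ++ k) (l' ++ k') (g + g') :=
  (h.append_right k).trans (h'.append_left l')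

theorem Reach.join (a b c d : α) (l : List (α × α)) :
    Reach w ((a, b) :: (c, d) :: l) ((a, d) :: l) (w b c) := fun _ _ hv =>
  Closes.join _ _ _ _ _ _ hv

theorem Reach.swap (a b : α) (l : List (α × α)) :
    Reach w ((a, b) :: l) ((b, a) :: l) 0 := fun _ _ hv =>
  (Closes.swap _ _ _ _ hv).mono _ _ _ (by simp)

theorem Reach.closes {l l' : List (α × α)} {g v : ℝ} (h : Reach w l l' g) (hv : Closes w l' v) :
    Closes w l (v + g) := by
  simpa using h [] v (by simpa using hv)

/-- A group of paths which can be connected to a single path in several ways, in such a way that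
the average gain is at least `v`, where an end of the resulting path counts half of its
distance to an arbitrary point. -/
def IsBlock (w : α → α → ℝ) (P : List (α × α)) (v : ℝ) : Prop :=
  ∃ (ι : Type) (_ : Fintype ι) (_ : Nonempty ι) (a b : ι → α) (g : ι → ℝ),
    (∀ i, Reach w P [(a i, b i)] (g i)) ∧
    (∀ y, v ≤ 𝔼 i, (g i + (w (a i) y + w (b i) y) / 2)) ∧ Closes w P v

theorem exists_le_of_le_avg {ι : Type*} [Fintype ι] [Nonempty ι] {f : ι → ℝ} {a : ℝ}
    (h : a ≤ 𝔼 i, f i) : ∃ i, a ≤ f i := by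
  obtain ⟨i, -, hi⟩ := Finset.exists_le_of_le_expect univ_nonempty h
  exact ⟨i, hi⟩

theorem isBlock_singleton (hw : MetricWeight w) (a b : α) : IsBlock w [(a, b)] (w a b / 2) := by
  refine ⟨Unit, inferInstance, inferInstance, fun _ => a, fun _ => b, fun _ => 0,
    fun _ => Reach.refl _, fun y => ?_, (Closes.close a b).mono _ _ _ ?_⟩
  · have := hw.tri a y b
    rw [hw.symm y b] at this
    simp
    linarith
  · linarith [hw.nonneg a b]

/-- Total list of paths of a list of blocks. -/
def blockPaths (bs : List (List (α × α) × ℝ)) : List (α × α) := (bs.map Prod.fst).flatten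

/-- Total value of a list of blocks. -/
def blockValue (bs : List (List (α × α) × ℝ)) : ℝ := (bs.map Prod.snd).sum

/-- Functions which are averages of distances to points. -/
def IsPotential (w : α → α → ℝ) (r : α → ℝ) : Prop :=
  ∃ (ι : Type) (_ : Fintype ι) (_ : Nonempty ι) (c d : ι → α),
    ∀ y, r y = 𝔼 i, (w (c i) y + w (d i) y) / 2

theorem IsPotential.le_avg (hw : MetricWeight w) {r : α → ℝ} (hr : IsPotential w r) {ι : Type*}
    [Fintype ι] {a b : ι → α} {g : ι → ℝ} {v : ℝ}
    (hv : ∀ y, v ≤ 𝔼 i, (g i + (w (a i) y + w (b i) y) / 2)) :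
    v ≤ 𝔼 i, (g i + (r (a i) + r (b i)) / 2) := by
  obtain ⟨κ, _, _, c, d, hr⟩ := hr
  have key : 𝔼 i, (g i + (r (a i) + r (b i)) / 2) =
      𝔼 j, ((𝔼 i, (g i + (w (a i) (c j) + w (b i) (c j)) / 2)) / 2 +
        (𝔼 i, (g i + (w (a i) (d j) + w (b i) (d j)) / 2)) / 2) := by
    have : ∀ j, ((𝔼 i, (g i + (w (a i) (c j) + w (b i) (c j)) / 2)) / 2 +
        (𝔼 i, (g i + (w (a i) (d j) + w (b i) (d j)) / 2)) / 2) =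
        𝔼 i, (g i + ((w (c j) (a i) + w (d j) (a i)) / 2 +
          (w (c j) (b i) + w (d j) (b i)) / 2) / 2) := by
      intro j
      rw [Finset.expect_div, Finset.expect_div, ← Finset.expect_add_distrib]
      refine Finset.expect_congr rfl fun i _ => ?_
      rw [hw.symm (a i), hw.symm (a i), hw.symm (b i), hw.symm (b i)]
      ring
    simp_rw [this, hr]
    rw [Finset.expect_comm]
    refine Finset.expect_congr rfl fun i _ => ?_
    rw [← Finset.expect_add_distrib, Finset.expect_div, ← Fintype.expect_const (ι := κ) (g i),
      ← Finset.expect_add_distrib]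
    simp
  rw [key]
  refine Finset.le_expect univ_nonempty fun j _ => ?_
  linarith [hv (c j), hv (d j)]

theorem isPotential_dist (s : α) : IsPotential w (w s) :=
  ⟨Unit, inferInstance, inferInstance, fun _ => s, fun _ => s, fun y => by simp⟩

theorem closes_chain_cons (hw : MetricWeight w) {P t : List (α × α)} {v u : ℝ}
    (hP : IsBlock w P v) : ∃ r : α → ℝ, IsPotential w r ∧
      ∀ s y, (∃ q, IsPotential w q ∧ ∀ x, Closes w ((s, x) :: t) (q x + u)) →
        Closes w ((s, y) :: (P ++ t)) (r y + (v + u)) := by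
  obtain ⟨ι, _, _, a, b, g, hr, hv, -⟩ := hP
  refine ⟨fun y => 𝔼 i, (w (a i) y + w (b i) y) / 2, ⟨ι, _, ‹_›, a, b, fun _ => rfl⟩, ?_⟩
  rintro s y ⟨q, hq, hc⟩
  have h1 := hq.le_avg hw hv
  have h2 : 𝔼 i, (w (a i) y + w (b i) y) / 2 + (v + u) ≤
      𝔼 i, ((w (a i) y + w (b i) y) / 2 + (g i + (q (a i) + q (b i)) / 2) + u) := by
    rw [Finset.expect_add_distrib, Finset.expect_add_distrib, Fintype.expect_const]
    linarith
  obtain ⟨i, hi⟩ := exists_le_of_le_avg h2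
  have h3 : Reach w ((s, y) :: (P ++ t)) ((s, y) :: (a i, b i) :: t) (g i) :=
    ((hr i).append_right t).append_left [(s, y)]
  have h4 : Reach w ((s, y) :: (a i, b i) :: t) ((s, b i) :: t) (w y (a i)) := Reach.join _ _ _ _ _
  have h5 : Reach w ((s, y) :: (a i, b i) :: t) ((s, a i) :: t) (w y (b i)) :=
    (((Reach.swap (a i) (b i) t).append_left [(s, y)]).trans (Reach.join _ _ _ _ _)).mono (by simp)
  have h6 := (h3.trans h4).closes (hc _)
  have h7 := (h3.trans h5).closes (hc _)
  rw [hw.symm y] at h6 h7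
  rcases le_total (q (b i) + u + (g i + w (a i) y)) (q (a i) + u + (g i + w (b i) y)) with h | h
  · exact h7.mono _ _ _ (by linarith)
  · exact h6.mono _ _ _ (by linarith)

theorem closes_chain (hw : MetricWeight w) :
    ∀ (bs : List (List (α × α) × ℝ)) (P : List (α × α)) (v : ℝ), IsBlock w P v →
      (∀ b ∈ bs, IsBlock w b.1 b.2) → ∃ r : α → ℝ, IsPotential w r ∧
        ∀ s y, Closes w ((s, y) :: (P ++ blockPaths bs)) (r y + (v + blockValue bs)) := by
  intro bs
  induction bs with
  | nil =>
    intro P v hP _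
    obtain ⟨r, hr, h⟩ := closes_chain_cons (t := []) (u := 0) hw hP
    exact ⟨r, hr, fun s y => h s y
      ⟨w s, isPotential_dist s, fun x => (Closes.close s x).mono _ _ _ (by simp)⟩⟩
  | cons B bs ih =>
    intro P v hP hbs
    obtain ⟨q, hq, hc⟩ := ih B.1 B.2 (hbs B (by simp)) fun b hb => hbs b (by simp [hb])
    obtain ⟨r, hr, h⟩ := closes_chain_cons (t := B.1 ++ blockPaths bs)
      (u := B.2 + blockValue bs) hw hP
    exact ⟨r, hr, fun s y => h s y ⟨q, hq, hc s⟩⟩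

theorem closes_blocks (hw : MetricWeight w) (bs : List (List (α × α) × ℝ))
    (hbs : ∀ b ∈ bs, IsBlock w b.1 b.2) : Closes w (blockPaths bs) (blockValue bs) := by
  match bs, hbs with
  | [], _ => exact Closes.nil
  | [B], hbs =>
    obtain ⟨-, -, -, -, -, -, -, -, h⟩ := hbs B (by simp)
    simpa [blockPaths, blockValue] using h
  | B :: C :: bs, hbs =>
    obtain ⟨q, hq, hc⟩ := closes_chain hw bs C.1 C.2 (hbs C (by simp))
      fun b hb => hbs b (by simp [hb])
    obtain ⟨ι, _, _, a, b, g, hr, hv, -⟩ := hbs B (by simp)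
    obtain ⟨i, hi⟩ := exists_le_of_le_avg (hq.le_avg hw hv)
    have h1 := ((hr i).append_right _).closes (hc (a i) (b i))
    have h2 := (((hr i).append_right _).trans (Reach.swap _ _ _)).closes (hc (b i) (a i))
    rcases le_total (q (a i)) (q (b i)) with h | h
    · exact h1.mono _ _ _ (by simp only [blockValue, List.map_cons, List.sum_cons]; linarith)
    · exact h2.mono _ _ _ (by simp only [blockValue, List.map_cons, List.sum_cons]; linarith)

end Blocks

section Reduction

variable {α : Type*} {w : α → α → ℝ}

/-- The ends of the paths in `l`. -/
def ends (l : List (α × α)) : List α := l.flatMap fun p => [p.1, p.2]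

@[simp] theorem ends_nil : ends ([] : List (α × α)) = [] := rfl

@[simp] theorem ends_cons (a b : α) (l : List (α × α)) : ends ((a, b) :: l) = a :: b :: ends l :=
  rfl

/-- `l` has exactly the ends `E`, without repetition. -/
def HasEnds (l : List (α × α)) (E : List α) : Prop := (ends l).Perm E ∧ E.Nodup

theorem HasEnds.perm {l : List (α × α)} {E E' : List α} (h : HasEnds l E) (hE : E.Perm E') :
    HasEnds l E' :=
  ⟨h.1.trans hE, hE.nodup_iff.1 h.2⟩

/-- `a` and `b` are the two ends of a path in `l`. -/
def Partner (l : List (α × α)) (a b : α) : Prop := (a, b) ∈ l ∨ (b, a) ∈ l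

theorem Partner.symm {l : List (α × α)} {a b : α} (h : Partner l a b) : Partner l b a := Or.symm h

theorem partner_cons {l : List (α × α)} {a b c d : α} :
    Partner ((a, b) :: l) c d ↔ (c = a ∧ d = b) ∨ (c = b ∧ d = a) ∨ Partner l c d := by
  simp only [Partner, List.mem_cons, Prod.mk.injEq]
  tauto

theorem Partner.mem {l : List (α × α)} {a b : α} (h : Partner l a b) : a ∈ ends l := by
  rcases h with h | h
  · exact List.mem_flatMap.2 ⟨_, h, by simp⟩
  · exact List.mem_flatMap.2 ⟨_, h, by simp⟩

theorem exists_partner {l : List (α × α)} {a : α} (h : a ∈ ends l) : ∃ b, Partner l a b := by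
  obtain ⟨⟨c, d⟩, hm, hp⟩ := List.mem_flatMap.1 h
  simp only [List.mem_cons, List.not_mem_nil, or_false] at hp
  rcases hp with rfl | rfl
  · exact ⟨d, Or.inl hm⟩
  · exact ⟨c, Or.inr hm⟩

/-- `l` and `l'` list the same paths up to order and orientation. -/
def SamePaths (w : α → α → ℝ) (l l' : List (α × α)) : Prop :=
  Reach w l l' 0 ∧ (ends l).Perm (ends l') ∧ ∀ c d, Partner l c d ↔ Partner l' c d

theorem SamePaths.of_perm {l l' : List (α × α)} (h : l.Perm l') : SamePaths w l l' :=
  ⟨Reach.perm h, h.flatMap_right _, fun c d => by simp [Partner, h.mem_iff]⟩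

theorem SamePaths.trans {l l' l'' : List (α × α)} (h : SamePaths w l l')
    (h' : SamePaths w l' l'') : SamePaths w l l'' :=
  ⟨(h.1.trans h'.1).mono (by simp), h.2.1.trans h'.2.1, fun c d => (h.2.2 c d).trans (h'.2.2 c d)⟩

theorem SamePaths.swap (a b : α) (l : List (α × α)) :
    SamePaths w ((a, b) :: l) ((b, a) :: l) :=
  ⟨Reach.swap _ _ _, List.Perm.swap _ _ _, fun c d => by simp only [partner_cons]; tauto⟩

theorem Partner.exists_samePaths (w : α → α → ℝ) {l : List (α × α)} {a b : α}
    (h : Partner l a b) : ∃ l', SamePaths w l ((a, b) :: l') := by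
  rcases h with h | h
  · obtain ⟨s, t, rfl⟩ := List.append_of_mem h
    exact ⟨s ++ t, SamePaths.of_perm List.perm_middle⟩
  · obtain ⟨s, t, rfl⟩ := List.append_of_mem h
    exact ⟨s ++ t, (SamePaths.of_perm List.perm_middle).trans (SamePaths.swap _ _ _)⟩

theorem Partner.unique {l : List (α × α)} {E : List α} (hl : HasEnds l E) {a b c : α}
    (h : Partner l a b) (h' : Partner l a c) : b = c := by
  obtain ⟨l', h1, h2, h3⟩ := h.exists_samePaths (fun _ _ => 0)
  have hn : (ends ((a, b) :: l')).Nodup := (hl.perm (hl.1.symm.trans h2)).2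
  rw [h3, partner_cons] at h'
  simp only [ends_cons, List.nodup_cons, List.mem_cons, not_or] at hn
  rcases h' with h | h | h
  · exact h.2.symm
  · exact absurd h.1 hn.1.1
  · exact absurd h.mem hn.1.2

/-- Connecting some of the paths in `l`, and splitting off some blocks, can give the paths in `l'`,
with a total gain and block value of at least `g`. -/
def Reduces (w : α → α → ℝ) (l l' : List (α × α)) (g : ℝ) : Prop :=
  ∃ (bs : List (List (α × α) × ℝ)) (u : ℝ), (∀ b ∈ bs, IsBlock w b.1 b.2) ∧
    Reach w l (l' ++ blockPaths bs) u ∧ g ≤ u + blockValue bs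

theorem Reach.reduces {l l' : List (α × α)} {g : ℝ} (h : Reach w l l' g) : Reduces w l l' g :=
  ⟨[], g, by simp, by simpa [blockPaths] using h, by simp [blockValue]⟩

theorem IsBlock.reduces {P : List (α × α)} {v : ℝ} (h : IsBlock w P v) (l : List (α × α)) :
    Reduces w (P ++ l) l v :=
  ⟨[(P, v)], 0, by simpa using h, Reach.perm (by simpa [blockPaths] using List.perm_append_comm),
    by simp [blockValue]⟩

theorem Reduces.mono {l l' : List (α × α)} {g g' : ℝ} (h : Reduces w l l' g) (hg : g' ≤ g) :
    Reduces w l l' g' := by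
  obtain ⟨bs, u, h1, h2, h3⟩ := h
  exact ⟨bs, u, h1, h2, hg.trans h3⟩

theorem Reduces.append_right {l l' : List (α × α)} {g : ℝ} (h : Reduces w l l' g)
    (k : List (α × α)) : Reduces w (l ++ k) (l' ++ k) g := by
  obtain ⟨bs, u, h1, h2, h3⟩ := h
  refine ⟨bs, u, h1, ((h2.append_right k).trans (Reach.perm ?_)).mono (by simp), h3⟩
  rw [List.append_assoc, List.append_assoc]
  exact List.perm_append_comm.append_left _

theorem Reduces.trans {l l' l'' : List (α × α)} {g g' : ℝ} (h : Reduces w l l' g)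
    (h' : Reduces w l' l'' g') : Reduces w l l'' (g + g') := by
  obtain ⟨bs, u, h1, h2, h3⟩ := h
  obtain ⟨bs', u', h1', h2', h3'⟩ := h'
  refine ⟨bs' ++ bs, u + u', ?_, ?_, ?_⟩
  · intro b hb
    rcases List.mem_append.1 hb with hb | hb
    · exact h1' b hb
    · exact h1 b hb
  · have := h2.trans (h2'.append_right (blockPaths bs))
    simpa [blockPaths] using this
  · simp only [blockValue, List.map_append, List.sum_append] at *
    linarith

theorem Reduces.closes (hw : MetricWeight w) {l : List (α × α)} {g : ℝ}
    (h : Reduces w l [] g) : Closes w l g := by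
  obtain ⟨bs, u, h1, h2, h3⟩ := h
  exact (h2.closes (by simpa using closes_blocks hw bs h1)).mono _ _ _ (by linarith)

theorem exists_attach_join (w : α → α → ℝ) {l : List (α × α)} {a b : α} {E : List α}
    (hl : HasEnds l (a :: b :: E)) (hab : ¬ Partner l a b) : ∃ l', HasEnds l' E ∧
      (∀ P P' z z' g g', (∀ y, Reach w ((a, y) :: P) [(z, y)] g) →
        (∀ y, Reach w ((b, y) :: P') [(z', y)] g') →
        Reach w (l ++ (P ++ P')) l' (g + g' + w z z')) ∧
      ∀ c d, Partner l' c d → Partner l c d ∨ (Partner l a c ∧ Partner l b d) ∨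
        (Partner l a d ∧ Partner l b c) := by
  have ha : a ∈ ends l := hl.1.mem_iff.2 (by simp)
  have hb : b ∈ ends l := hl.1.mem_iff.2 (by simp)
  have hne : a ≠ b := by
    have := hl.2
    simp only [List.nodup_cons, List.mem_cons, not_or] at this
    exact this.1.1
  obtain ⟨c, hc⟩ := exists_partner ha
  obtain ⟨l1, h1, h2, h3⟩ := hc.exists_samePaths w
  have hbc : b ≠ c := fun h => hab (h ▸ hc)
  have hb1 : b ∈ ends l1 := by
    rw [h2.mem_iff] at hb
    simpa [hne.symm, hbc] using hb
  obtain ⟨d, hd⟩ := exists_partner hb1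
  obtain ⟨l2, h4, h5, h6⟩ := hd.exists_samePaths w
  have hp : (ends ((c, d) :: l2)).Perm E := by
    have : (a :: b :: E).Perm (a :: b :: ends ((c, d) :: l2)) :=
      (hl.1.symm.trans h2).trans
        (List.Perm.cons a ((h5.cons c).trans (List.Perm.swap _ _ _)))
    exact this.cons_inv.cons_inv.symm
  refine ⟨(c, d) :: l2, ⟨hp, hl.2.of_cons.of_cons⟩, ?_, ?_⟩
  · intro P P' z z' g g' hP hP'
    have r1 : Reach w (l ++ (P ++ P')) ((a, c) :: (b, d) :: l2 ++ (P ++ P')) 0 :=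
      ((h1.trans (h4.append_left [(a, c)])).append_right _).mono (by simp)
    have p1 : ((a, c) :: (b, d) :: l2 ++ (P ++ P')).Perm
        ((((a, c) :: P) ++ ((b, d) :: P')) ++ l2) := by
      simp only [List.append_assoc, List.cons_append]
      refine List.Perm.cons _ (List.Perm.trans (List.Perm.cons _ ?_) List.perm_middle.symm)
      rw [← List.append_assoc P]
      exact List.perm_append_comm
    have r2 : Reach w ((((a, c) :: P) ++ ((b, d) :: P')) ++ l2)
        ((z, c) :: (z', d) :: l2) (g + g') := ((hP c).append (hP' d)).append_right l2
    exact (((r1.trans (Reach.perm p1)).trans r2).trans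
      ((Reach.swap _ _ _).trans (Reach.join _ _ _ _ _))).mono (by simp)
  · intro x y hxy
    have hbd : Partner l b d := (h3 _ _).2 (partner_cons.2 (Or.inr (Or.inr hd)))
    rcases partner_cons.1 hxy with ⟨rfl, rfl⟩ | ⟨rfl, rfl⟩ | hxy
    · exact Or.inr (Or.inl ⟨hc, hbd⟩)
    · exact Or.inr (Or.inr ⟨hc, hbd⟩)
    · exact Or.inl ((h3 _ _).2 (partner_cons.2 (Or.inr (Or.inr
        ((h6 _ _).2 (partner_cons.2 (Or.inr (Or.inr hxy))))))))

theorem exists_join {l : List (α × α)} {a b : α} {E : List α} (hl : HasEnds l (a :: b :: E))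
    (hab : ¬ Partner l a b) : ∃ l', HasEnds l' E ∧ Reduces w l l' (w a b) ∧
      ∀ c d, Partner l' c d → Partner l c d ∨ (Partner l a c ∧ Partner l b d) ∨
        (Partner l a d ∧ Partner l b c) := by
  obtain ⟨l', h1, h2, h3⟩ := exists_attach_join w hl hab
  refine ⟨l', h1, ?_, h3⟩
  simpa using (h2 [] [] a b 0 0 (fun y => Reach.refl _) fun y => Reach.refl _).reduces

theorem exists_split (w : α → α → ℝ) {l : List (α × α)} {a b : α} {E : List α}
    (hl : HasEnds l (a :: b :: E)) (hab : Partner l a b) :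
    ∃ l', HasEnds l' E ∧ Reach w l ((a, b) :: l') 0 ∧
      (∀ c d, Partner l' c d → Partner l c d) ∧
      ∀ c d, c ≠ a → c ≠ b → Partner l c d → Partner l' c d := by
  obtain ⟨l1, h1, h2, h3⟩ := hab.exists_samePaths w
  refine ⟨l1, ⟨(h2.symm.trans hl.1).cons_inv.cons_inv, hl.2.of_cons.of_cons⟩, h1, ?_, ?_⟩
  · exact fun c d h => (h3 _ _).2 (partner_cons.2 (Or.inr (Or.inr h)))
  · intro c d ha hb h
    rcases partner_cons.1 ((h3 _ _).1 h) with h | h | h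
    · exact absurd h.1 ha
    · exact absurd h.1 hb
    · exact h

theorem exists_half (hw : MetricWeight w) {l : List (α × α)} {a b : α} {E : List α}
    (hl : HasEnds l (a :: b :: E)) : ∃ l', HasEnds l' E ∧ Reduces w l l' (w a b / 2) := by
  by_cases hab : Partner l a b
  · obtain ⟨l', h1, h2, -⟩ := exists_split w hl hab
    exact ⟨l', h1, (h2.reduces.trans ((isBlock_singleton hw a b).reduces l')).mono (by simp)⟩
  · obtain ⟨l', h1, h2, -⟩ := exists_join (w := w) hl hab
    exact ⟨l', h1, h2.mono (by linarith [hw.nonneg a b])⟩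

/-- Weight of the matching consisting of every other edge of the path `L`. -/
def altWeight (w : α → α → ℝ) : List α → ℝ
  | a :: b :: L => w a b + altWeight w L
  | _ => 0

theorem exists_half_even (hw : MetricWeight w) {E : List α} : ∀ (L : List α), Even L.length →
    ∀ {l : List (α × α)}, HasEnds l (L ++ E) →
      ∃ l', HasEnds l' E ∧ Reduces w l l' (altWeight w L / 2)
  | [], _, l, hl => ⟨l, hl, by simpa [altWeight] using (Reach.refl l).reduces⟩
  | [a], h, _, _ => by simp at h
  | a :: b :: L, h, l, hl => by
    obtain ⟨l1, h1, h2⟩ := exists_half hw hl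
    obtain ⟨l2, h3, h4⟩ := exists_half_even hw L
      (by simpa [Nat.even_add_one] using h) h1
    exact ⟨l2, h3, (h2.trans h4).mono (by simp only [altWeight]; linarith)⟩

theorem exists_half_odd (hw : MetricWeight w) {E : List α} : ∀ (L : List α), Odd L.length →
    ∀ {l : List (α × α)}, HasEnds l (L ++ E) →
      ∃ z l', HasEnds l' (z :: E) ∧ Reduces w l l' (altWeight w L / 2)
  | [], h, _, _ => by simp at h
  | [a], _, l, hl => ⟨a, l, hl, by simpa [altWeight] using (Reach.refl l).reduces⟩
  | a :: b :: L, h, l, hl => by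
    obtain ⟨l1, h1, h2⟩ := exists_half hw hl
    obtain ⟨z, l2, h3, h4⟩ := exists_half_odd hw L
      (by simpa [Nat.odd_add_one, Nat.even_add_one] using h) h1
    exact ⟨z, l2, h3, (h2.trans h4).mono (by simp only [altWeight]; linarith)⟩

theorem exists_join_join {l : List (α × α)} {a b c d : α} {E : List α}
    (hl : HasEnds l (a :: b :: c :: d :: E)) (hab : ¬ Partner l a b) (hcd : ¬ Partner l c d)
    (h1 : ¬ (Partner l a c ∧ Partner l b d)) (h2 : ¬ (Partner l a d ∧ Partner l b c)) :
    ∃ l', HasEnds l' E ∧ Reduces w l l' (w a b + w c d) := by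
  obtain ⟨l1, h3, h4, h5⟩ := exists_join (w := w) hl hab
  obtain ⟨l2, h6, h7, -⟩ := exists_join (w := w) h3 (fun h => by
    rcases h5 _ _ h with h | h | h
    exacts [hcd h, h1 h, h2 h])
  exact ⟨l2, h6, h4.trans h7⟩

end Reduction

section Combinatorics

variable {α : Type*} {P : α → α → Prop}

/-- In the partial matching `P`, neither `a, b` nor `c, d` are matched, and the matched pairs do
not connect the edges `a b` and `c d` to a cycle. -/
def Independent (P : α → α → Prop) (a b c d : α) : Prop :=
  ¬ P a b ∧ ¬ P c d ∧ ¬ (P a c ∧ P b d) ∧ ¬ (P a d ∧ P b c)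

theorem independent_of_five (hs : ∀ a b, P a b → P b a)
    (hu : ∀ a b c, P a b → P a c → b = c) {a b c d e : α} (hn : [a, b, c, d, e].Nodup) :
    Independent P a b c d ∨ Independent P b c d e ∨
      ((¬ P a b ∨ ¬ P c d) ∧ (¬ P b c ∨ ¬ P d e)) := by
  simp only [List.nodup_cons, List.mem_cons, not_or, Independent] at *
  grind

theorem independent_or_of_five (hs : ∀ a b, P a b → P b a)
    (hu : ∀ a b c, P a b → P a c → b = c) {a b c d e : α} (hn : [a, b, c, d, e].Nodup) :
    (Independent P a b c d ∧ (¬ P b c ∨ ¬ P d e)) ∨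
    (Independent P b c d e ∧ (¬ P a b ∨ ¬ P c d)) ∨
    (P a b ∧ P c d) ∨ (P b c ∧ P d e) ∨ (P c d ∧ P e a) ∨ (P d e ∧ P a b) ∨ (P e a ∧ P b c) ∨
    (P a b ∧ P c e) ∨ (P b c ∧ P d a) ∨ (P c d ∧ P e b) ∨ (P d e ∧ P a c) ∨ (P e a ∧ P b d) := by
  simp only [List.nodup_cons, List.mem_cons, not_or, Independent] at *
  grind

theorem independent_or_of_seven (hs : ∀ a b, P a b → P b a)
    (hu : ∀ a b c, P a b → P a c → b = c) {a b c d e f g : α} (hn : [a, b, c, d, e, f, g].Nodup) :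
    (P a b ∧ P c d ∧ P e f) ∨ (P b c ∧ P d e ∧ P f g) ∨
    ((Independent P a b c d ∨ Independent P a b e f ∨ Independent P c d e f) ∧
      (¬ P b c ∨ ¬ P d e ∨ ¬ P f g)) ∨
    ((Independent P b c d e ∨ Independent P b c f g ∨ Independent P d e f g) ∧
      (¬ P a b ∨ ¬ P c d ∨ ¬ P e f)) := by
  simp only [List.nodup_cons, List.mem_cons, not_or, Independent] at *
  grind

theorem perm_swap_pairs (a b c d : α) (L : List α) :
    (a :: b :: c :: d :: L).Perm (c :: d :: a :: b :: L) :=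
  (List.perm_append_comm (l₁ := [a, b]) (l₂ := [c, d])).append_right L

theorem perm_swap_triples (a b c d e f : α) (L : List α) :
    (a :: b :: c :: d :: e :: f :: L).Perm (e :: f :: a :: b :: c :: d :: L) :=
  (List.perm_append_comm (l₁ := [a, b, c, d]) (l₂ := [e, f])).append_right L

end Combinatorics

section Cycles

variable {α : Type*} {w : α → α → ℝ}

/-- Leaving only some of the ends in `L` and all the ends in `E`, a gain of `g` can be realized. -/
def Gains (w : α → α → ℝ) (l : List (α × α)) (E : List α) (g : ℝ) : Prop :=
  ∃ Z l', HasEnds l' (Z ++ E) ∧ Reduces w l l' g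

theorem Gains.mono {l : List (α × α)} {E : List α} {g g' : ℝ} (h : Gains w l E g) (hg : g' ≤ g) :
    Gains w l E g' := by
  obtain ⟨Z, l', h1, h2⟩ := h
  exact ⟨Z, l', h1, h2.mono hg⟩

theorem Reduces.gains {l l' : List (α × α)} {E : List α} {g g' : ℝ} (h : Reduces w l l' g)
    (h' : Gains w l' E g') : Gains w l E (g + g') := by
  obtain ⟨Z, k, h1, h2⟩ := h'
  exact ⟨Z, k, h1, h.trans h2⟩

theorem gains_half (hw : MetricWeight w) {E : List α} (L : List α) {l : List (α × α)}
    (hl : HasEnds l (L ++ E)) : Gains w l E (altWeight w L / 2) := by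
  rcases Nat.even_or_odd L.length with h | h
  · obtain ⟨l', h1, h2⟩ := exists_half_even hw L h hl
    exact ⟨[], l', h1, h2⟩
  · obtain ⟨z, l', h1, h2⟩ := exists_half_odd hw L h hl
    exact ⟨[z], l', h1, h2⟩

theorem gains_one (hw : MetricWeight w) {E L : List α} {a b : α} {l : List (α × α)}
    (hl : HasEnds l (a :: b :: L ++ E)) (hab : ¬ Partner l a b) :
    Gains w l E (w a b + altWeight w L / 2) := by
  obtain ⟨l', h1, h2, -⟩ := exists_join (w := w) hl hab
  exact h2.gains (gains_half hw L h1)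

theorem gains_two (hw : MetricWeight w) {E L : List α} {a b c d : α} {l : List (α × α)}
    (hl : HasEnds l (a :: b :: c :: d :: L ++ E)) (h : Independent (Partner l) a b c d) :
    Gains w l E (w a b + w c d + altWeight w L / 2) := by
  obtain ⟨l', h1, h2⟩ := exists_join_join (w := w) hl h.1 h.2.1 h.2.2.1 h.2.2.2
  exact h2.gains (gains_half hw L h1)

theorem gains_one_of_four (hw : MetricWeight w) {E L : List α} {a b c d : α} {l : List (α × α)}
    (hl : HasEnds l (a :: b :: c :: d :: L ++ E)) (h : ¬ Partner l a b ∨ ¬ Partner l c d)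
    {m : ℝ} (hab : m ≤ w a b) (hcd : m ≤ w c d) :
    Gains w l E (altWeight w (a :: b :: c :: d :: L) / 2 + m / 2) := by
  rcases h with h | h
  · exact (gains_one hw hl h).mono (by simp only [altWeight]; linarith)
  · exact (gains_one (L := a :: b :: L) hw (hl.perm (perm_swap_pairs _ _ _ _ _)) h).mono
      (by simp only [altWeight]; linarith)

theorem gains_one_of_six (hw : MetricWeight w) {E L : List α} {a b c d e f : α}
    {l : List (α × α)} (hl : HasEnds l (a :: b :: c :: d :: e :: f :: L ++ E))
    (h : ¬ Partner l a b ∨ ¬ Partner l c d ∨ ¬ Partner l e f)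
    {m : ℝ} (hab : m ≤ w a b) (hcd : m ≤ w c d) (hef : m ≤ w e f) :
    Gains w l E (altWeight w (a :: b :: c :: d :: e :: f :: L) / 2 + m / 2) := by
  rcases h with h | h | h
  · exact gains_one_of_four hw hl (Or.inl h) hab hcd
  · exact gains_one_of_four hw hl (Or.inr h) hab hcd
  · exact (gains_one (L := a :: b :: c :: d :: L) hw
      (hl.perm (perm_swap_triples _ _ _ _ _ _ _)) h).mono (by simp only [altWeight]; linarith)

theorem gains_two_of_six (hw : MetricWeight w) {E L : List α} {a b c d e f : α}
    {l : List (α × α)} (hl : HasEnds l (a :: b :: c :: d :: e :: f :: L ++ E))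
    (h : Independent (Partner l) a b c d ∨ Independent (Partner l) a b e f ∨
      Independent (Partner l) c d e f)
    {m : ℝ} (hab : m ≤ w a b) (hcd : m ≤ w c d) (hef : m ≤ w e f) :
    Gains w l E (altWeight w (a :: b :: c :: d :: e :: f :: L) / 2 + m) := by
  rcases h with h | h | h
  · exact (gains_two hw hl h).mono (by simp only [altWeight]; linarith)
  · exact (gains_two (L := c :: d :: L) hw
      (hl.perm (((perm_swap_pairs _ _ _ _ _).cons _).cons _)) h).mono
      (by simp only [altWeight]; linarith)
  · exact (gains_two (L := a :: b :: L) hw (hl.perm ((perm_swap_pairs _ _ _ _ _).trans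
      (((perm_swap_pairs _ _ _ _ _).cons _).cons _))) h).mono
      (by simp only [altWeight]; linarith)

theorem gains_three (hw : MetricWeight w) {E L : List α} {a b c d e f : α}
    {l : List (α × α)} (hl : HasEnds l (a :: b :: c :: d :: e :: f :: L ++ E))
    (hab : ¬ Partner l a b) (ha : ∀ x ∈ [c, d, e, f], ¬ Partner l a x)
    (h : Independent (Partner l) c d e f) :
    Gains w l E (w a b + w c d + w e f + altWeight w L / 2) := by
  obtain ⟨l', h1, h2, h3⟩ := exists_join (w := w) hl hab
  have key : ∀ x y, x ∈ [c, d, e, f] → y ∈ [c, d, e, f] → Partner l' x y → Partner l x y := by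
    intro x y hx hy hxy
    rcases h3 _ _ hxy with h | h | h
    exacts [h, absurd h.1 (ha x hx), absurd h.1 (ha y hy)]
  refine (h2.gains (gains_two hw (L := L) h1 ⟨?_, ?_, ?_, ?_⟩)).mono (by linarith)
  · exact fun hp => h.1 (key _ _ (by simp) (by simp) hp)
  · exact fun hp => h.2.1 (key _ _ (by simp) (by simp) hp)
  · exact fun hp => h.2.2.1 ⟨key _ _ (by simp) (by simp) hp.1, key _ _ (by simp) (by simp) hp.2⟩
  · exact fun hp => h.2.2.2 ⟨key _ _ (by simp) (by simp) hp.1, key _ _ (by simp) (by simp) hp.2⟩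

/-- Weight of the path `L`. -/
def pathWeight (w : α → α → ℝ) : List α → ℝ
  | a :: b :: L => w a b + pathWeight w (b :: L)
  | _ => 0

/-- Weight of the edge between the last and the first vertex of `L`. -/
def closingWeight (w : α → α → ℝ) : List α → ℝ
  | a :: L => w (L.getLastD a) a
  | [] => 0

theorem pathWeight_cons (w : α → α → ℝ) : ∀ (a : α) (L : List α),
    pathWeight w (a :: L) = altWeight w (a :: L) + altWeight w L
  | a, [] => by simp [pathWeight, altWeight]
  | a, b :: L => by
    rw [pathWeight, pathWeight_cons w b L, altWeight]
    ring

/-- `L` is a cycle whose closing edge is a shortest edge. -/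
def IsShortClosed (w : α → α → ℝ) (L : List α) : Prop :=
  3 ≤ L.length ∧ L.IsChain fun a b => closingWeight w L ≤ w a b

/-- A quarter of the weight of the cycle `L` plus half of the weight of the closing edge. -/
noncomputable def cycleValue (w : α → α → ℝ) (L : List α) : ℝ :=
  (pathWeight w L + closingWeight w L) / 4 + closingWeight w L / 2

theorem HasEnds.nodup_left {l : List (α × α)} {L E : List α} (h : HasEnds l (L ++ E)) :
    L.Nodup := (List.nodup_append.1 h.2).1

theorem HasEnds.partner_unique {l : List (α × α)} {E : List α} (hl : HasEnds l E) :
    ∀ a b c, Partner l a b → Partner l a c → b = c := fun _ _ _ h h' => h.unique hl h'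

theorem gains_six (hw : MetricWeight w) {a b c d e f : α} {E : List α}
    {l : List (α × α)} (hc : IsShortClosed w [a, b, c, d, e, f])
    (hl : HasEnds l ([a, b, c, d, e, f] ++ E)) :
    Gains w l E (cycleValue w [a, b, c, d, e, f]) := by
  have hl' : HasEnds l ([b, c, d, e, f, a] ++ E) :=
    hl.perm ((List.perm_append_comm (l₁ := [a])).append_right E)
  obtain ⟨-, hch⟩ := hc
  simp only [List.isChain_cons_cons, closingWeight, List.getLastD_cons, List.getLastD_nil] at hch
  obtain ⟨hab, hbc, hcd, hde, hef, -⟩ := hch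
  have h5 : [a, b, c, d, e].Nodup := by
    have := hl.nodup_left
    simp only [List.nodup_cons, List.mem_cons, not_or] at this ⊢
    tauto
  have combine : ∀ s t, 2 * w f a ≤ s + t →
      Gains w l E (altWeight w [a, b, c, d, e, f] / 2 + s / 2) →
      Gains w l E (altWeight w [b, c, d, e, f, a] / 2 + t / 2) →
      Gains w l E (cycleValue w [a, b, c, d, e, f]) := by
    intro s t hst hs ht
    simp only [altWeight] at hs ht
    simp only [cycleValue, pathWeight, closingWeight, List.getLastD_cons, List.getLastD_nil]
    rcases le_total ((w a b + (w c d + (w e f + 0))) / 2 + s / 2)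
      ((w b c + (w d e + (w f a + 0))) / 2 + t / 2) with h | h
    · exact ht.mono (by linarith)
    · exact hs.mono (by linarith)
  rcases independent_of_five (fun _ _ h => h.symm) hl.partner_unique h5 with h | h | ⟨h, h'⟩
  · refine combine (2 * w f a) 0 (by simp) ((gains_two hw hl h).mono ?_) ?_
    · simp only [altWeight]; linarith
    · simpa using gains_half hw _ hl'
  · refine combine 0 (2 * w f a) (by simp) ?_ ((gains_two hw hl' h).mono ?_)
    · simpa using gains_half hw _ hl
    · simp only [altWeight]; linarith
  · exact combine (w f a) (w f a) (by linarith) (gains_one_of_four hw hl h hab hcd)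
      (gains_one_of_four hw hl' h' hbc hde)

theorem gains_long (hw : MetricWeight w) {a b c d e f g : α} {L E : List α}
    {l : List (α × α)} (hc : IsShortClosed w (a :: b :: c :: d :: e :: f :: g :: L))
    (hl : HasEnds l (a :: b :: c :: d :: e :: f :: g :: L ++ E)) :
    Gains w l E (cycleValue w (a :: b :: c :: d :: e :: f :: g :: L)) := by
  have hW := pathWeight_cons w a (b :: c :: d :: e :: f :: g :: L)
  obtain ⟨-, hch⟩ := hc
  unfold cycleValue
  generalize closingWeight w (a :: b :: c :: d :: e :: f :: g :: L) = m at *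
  simp only [List.isChain_cons_cons] at hch
  obtain ⟨hab, hbc, hcd, hde, hef, hfg, -⟩ := hch
  have h7 : [a, b, c, d, e, f, g].Nodup := by
    have := hl.nodup_left
    simp only [List.nodup_cons, List.mem_cons, not_or] at this ⊢
    tauto
  have hl' : HasEnds l (b :: c :: d :: e :: f :: g :: L ++ (a :: E)) :=
    hl.perm (List.perm_middle (l₁ := b :: c :: d :: e :: f :: g :: L)).symm
  have drop : ∀ t, Gains w l (a :: E) t → Gains w l E t := by
    rintro t ⟨Z, l', h1, h2⟩
    exact ⟨Z ++ [a], l', by simpa using h1, h2⟩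
  have combine : ∀ s t, 3 * m ≤ s + t →
      Gains w l E (altWeight w (a :: b :: c :: d :: e :: f :: g :: L) / 2 + s / 2) →
      Gains w l (a :: E) (altWeight w (b :: c :: d :: e :: f :: g :: L) / 2 + t / 2) →
      Gains w l E ((pathWeight w (a :: b :: c :: d :: e :: f :: g :: L) + m) / 4 + m / 2) := by
    intro s t hst hs ht
    rcases le_total (altWeight w (a :: b :: c :: d :: e :: f :: g :: L) / 2 + s / 2)
      (altWeight w (b :: c :: d :: e :: f :: g :: L) / 2 + t / 2) with h | h
    · exact drop _ (ht.mono (by linarith))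
    · exact hs.mono (by linarith)
  have hu := hl.partner_unique
  have hs : ∀ x y, Partner l x y → Partner l y x := fun _ _ h => h.symm
  rcases independent_or_of_seven hs hu h7 with h | h | ⟨h, h'⟩ | ⟨h, h'⟩
  · refine combine 0 (3 * m) (by linarith) ?_ ((gains_three hw hl' ?_ ?_ ?_).mono ?_)
    · simpa using gains_half hw _ hl
    · simp only [List.nodup_cons, List.mem_cons, not_or] at h7
      grind
    · simp only [List.nodup_cons, List.mem_cons, not_or] at h7 ⊢
      grind
    · simp only [List.nodup_cons, List.mem_cons, not_or, Independent] at h7 ⊢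
      grind
    · simp only [altWeight]; linarith
  · refine combine (3 * m) 0 (by linarith) ((gains_three hw hl ?_ ?_ ?_).mono ?_) ?_
    · simp only [List.nodup_cons, List.mem_cons, not_or] at h7
      grind
    · simp only [List.nodup_cons, List.mem_cons, not_or] at h7 ⊢
      grind
    · simp only [List.nodup_cons, List.mem_cons, not_or, Independent] at h7 ⊢
      grind
    · simp only [altWeight]; linarith
    · simpa using gains_half hw _ hl'
  · refine combine (2 * m) m (by linarith)
      ((gains_two_of_six hw hl h hab hcd hef).mono (by linarith))
      (gains_one_of_six hw hl' h' hbc hde hfg)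
  · refine combine m (2 * m) (by linarith)
      (gains_one_of_six hw hl h' hab hcd hef)
      ((gains_two_of_six hw hl' h hbc hde hfg).mono (by linarith))

end Cycles

section Gadgets

open scoped BigOperators

variable {α : Type*} {w : α → α → ℝ}

/-- Paths `P` which can be appended in several ways to a path ending in `b`, in such a way that the
average gain is at least `v`, where the new end counts half of its distance to an arbitrary
point. -/
def IsGadget (w : α → α → ℝ) (b : α) (P : List (α × α)) (v : ℝ) : Prop :=
  ∃ (ι : Type) (_ : Fintype ι) (_ : Nonempty ι) (z : ι → α) (g : ι → ℝ),
    (∀ i y, Reach w ((b, y) :: P) [(z i, y)] (g i)) ∧ ∀ y, v ≤ 𝔼 i, (g i + w (z i) y / 2)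

/-- The ends of a cycle can be removed from `l` with gain `v`, either immediately or by turning
them into a gadget. -/
def Handles (w : α → α → ℝ) (l : List (α × α)) (E : List α) (v : ℝ) : Prop :=
  Gains w l E v ∨
    ∃ b P l', IsGadget w b P v ∧ HasEnds l' (b :: E) ∧ Reach w l (l' ++ P) 0

theorem Reach.extend (b y a d : α) (l : List (α × α)) :
    Reach w ((b, y) :: (a, d) :: l) ((d, y) :: l) (w b a) :=
  (((Reach.swap b y _).trans (Reach.join _ _ _ _ _)).trans (Reach.swap _ _ _)).mono (by simp)

theorem Reach.swap_second (p : α × α) (a d : α) (l : List (α × α)) :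
    Reach w (p :: (a, d) :: l) (p :: (d, a) :: l) 0 :=
  (Reach.swap a d l).append_left [p]

theorem isGadget_triangle (hw : MetricWeight w) {a b d : α} {v m : ℝ} (hab : m ≤ w b a)
    (hbd : m ≤ w b d) (hv : v ≤ (w b a + w b d + w a d) / 4 + m / 2) :
    IsGadget w b [(a, d)] v := by
  refine ⟨Bool, inferInstance, inferInstance, fun i => if i then a else d,
    fun i => if i then w b d else w b a, ?_, ?_⟩
  · rintro (_ | _) y
    · exact Reach.extend b y a d []
    · exact ((Reach.swap_second _ _ _ _).trans (Reach.extend b y d a [])).mono (by simp)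
  · intro y
    have := hw.tri a y d
    rw [hw.symm y d] at this
    rw [Fintype.expect_eq_sum_div_card]
    simp
    linarith

theorem isGadget_pentagon (hw : MetricWeight w) {b a₁ d₁ d₂ a₂ : α} {v m : ℝ}
    (h₁ : m ≤ w b a₁) (h₂ : m ≤ w b a₂)
    (hv : v ≤ (w b a₁ + w a₁ d₁ + w d₁ d₂ + w d₂ a₂ + w b a₂) / 4 + m / 2) :
    IsGadget w b [(a₁, d₁), (a₂, d₂)] v := by
  refine ⟨Fin 4, inferInstance, inferInstance, ![a₂, d₂, a₁, d₁],
    ![w b a₁ + w d₁ d₂, w b a₁ + w d₁ a₂, w b a₂ + w d₁ d₂, w b a₂ + w d₂ a₁], ?_, ?_⟩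
  · intro i y
    have hc : Reach w ((b, y) :: [(a₁, d₁), (a₂, d₂)]) ((b, y) :: [(a₂, d₂), (a₁, d₁)]) 0 :=
      Reach.perm ((List.Perm.swap _ _ _).cons _)
    fin_cases i
    · exact ((Reach.extend b y a₁ d₁ _).trans ((Reach.swap_second _ _ _ _).trans
        (Reach.extend _ _ _ _ _))).mono (by simp)
    · exact (Reach.extend b y a₁ d₁ _).trans (Reach.extend _ _ _ _ _)
    · exact (hc.trans ((Reach.extend b y a₂ d₂ _).trans ((Reach.swap_second _ _ _ _).trans
        (Reach.extend _ _ _ _ _)))).mono (by simp [hw.symm d₂ d₁])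
    · exact (hc.trans ((Reach.extend b y a₂ d₂ _).trans (Reach.extend _ _ _ _ _))).mono (by simp)
  · intro y
    have t1 := hw.tri a₁ y d₁
    have t2 := hw.tri a₂ y d₂
    have t3 := hw.tri a₂ d₁ d₂
    have t4 := hw.tri a₁ d₂ d₁
    have t5 := hw.nonneg a₁ d₂
    have t6 := hw.nonneg a₂ d₁
    rw [hw.symm y d₁] at t1
    rw [hw.symm y d₂] at t2
    rw [hw.symm d₂ d₁] at t4
    rw [Fintype.expect_eq_sum_div_card, Fin.sum_univ_four]
    simp only [Matrix.cons_val, Fintype.card_fin, Nat.cast_ofNat, hw.symm d₁ a₂, hw.symm d₂ a₁,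
      hw.symm d₂ a₂] at *
    rcases le_total (w d₁ d₂) ((w a₁ d₁ + w a₂ d₂) / 2) with h | h <;> linarith

theorem gains_pentagon (hw : MetricWeight w) {b a₁ d₁ d₂ a₂ : α} {v m : ℝ} {E : List α}
    {l : List (α × α)} (hl : HasEnds l ([b, a₁, d₁, d₂, a₂] ++ E)) (ha : Partner l a₁ a₂)
    (hd : Partner l d₁ d₂) (_ : m ≤ w b a₁) (h₂ : m ≤ w b a₂)
    (hv : v ≤ (w b a₁ + w a₁ d₁ + w d₁ d₂ + w d₂ a₂ + w b a₂) / 4 + m / 2) : Gains w l E v := by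
  have hn := hl.nodup_left
  have hu := hl.partner_unique
  have hs : ∀ x y, Partner l x y → Partner l y x := fun _ _ h => h.symm
  simp only [List.nodup_cons, List.mem_cons, not_or] at hn
  have e1 : HasEnds l ([b, a₁, d₂, a₂] ++ (d₁ :: E)) :=
    hl.perm (((List.perm_middle (l₁ := [d₂, a₂])).symm.cons _).cons _)
  have e2 : HasEnds l ([b, a₂, d₁, a₁] ++ (d₂ :: E)) :=
    hl.perm ((List.Perm.append_right E (l₁ := [a₁, d₁, d₂, a₂]) (l₂ := [a₂, d₁, a₁, d₂])
      (by
        refine ((List.perm_append_comm (l₁ := [a₁, d₁, d₂]) (l₂ := [a₂])).trans ?_)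
        refine List.Perm.cons _ ((List.Perm.swap _ _ _).trans (List.Perm.cons _ ?_))
        exact List.Perm.refl _)).cons _)
  have o1 := gains_two (L := []) hw e1 (by simp only [Independent]; grind)
  have o2 := gains_two (L := []) hw e2 (by simp only [Independent]; grind)
  have e3 : HasEnds l ([b, a₂, d₁, d₂] ++ (a₁ :: E)) := e2.perm
    ((((List.Perm.swap _ _ _).cons _).cons _).cons _)
  have e4 : HasEnds l ([b, a₁, d₁, d₂] ++ (a₂ :: E)) := hl.perm (List.Perm.refl _)
  have o3 := gains_one (L := [d₁, d₂]) hw e3 (by grind)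
  have o4 := gains_one (L := [d₁, d₂]) hw e4 (by grind)
  have drop : ∀ x t, Gains w l (x :: E) t → v ≤ t → Gains w l E v := by
    rintro x t ⟨Z, l', h1, h2⟩ ht
    exact ⟨Z ++ [x], l', by simpa using h1, h2.mono ht⟩
  by_contra hcon
  have n1 := lt_of_not_ge fun h => hcon (drop _ _ o1 h)
  have n2 := lt_of_not_ge fun h => hcon (drop _ _ o2 h)
  have n3 := lt_of_not_ge fun h => hcon (drop _ _ o3 h)
  have n4 := lt_of_not_ge fun h => hcon (drop _ _ o4 h)
  simp only [altWeight, hw.symm d₁ a₁] at *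
  linarith

end Gadgets

section Handling

open scoped BigOperators

variable {α : Type*} {w : α → α → ℝ}

theorem isBlock_square (hw : MetricWeight w) {a b c d : α} {v m : ℝ} (hbc : m ≤ w b c)
    (hda : m ≤ w d a) (hv : v ≤ (w a b + w b c + w c d + w d a) / 4 + m / 2) :
    IsBlock w [(a, b), (c, d)] v := by
  have r1 : Reach w [(a, b), (c, d)] [(a, d)] (w b c) := Reach.join _ _ _ _ _
  have r2 : Reach w [(a, b), (c, d)] [(b, c)] (w d a) :=
    (((Reach.swap _ _ _).trans (Reach.swap_second _ _ _ _)).trans (Reach.join _ _ _ _ _)).mono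
      (by simp [hw.symm d a])
  have r3 : Reach w [(a, b), (c, d)] [(a, c)] (w b d) :=
    ((Reach.swap_second _ _ _ _).trans (Reach.join _ _ _ _ _)).mono (by simp)
  have t1 := hw.tri a c b
  have t2 := hw.tri a d b
  have t3 := hw.tri c a d
  have t4 := hw.tri c b d
  refine ⟨Bool, inferInstance, inferInstance, fun i => if i then a else b,
    fun i => if i then d else c, fun i => if i then w b c else w d a, ?_, ?_, ?_⟩
  · rintro (_ | _)
    · exact r2
    · exact r1
  · intro y
    have t5 := hw.tri a y b
    have t6 := hw.tri c y d
    rw [hw.symm y b] at t5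
    rw [hw.symm y d] at t6
    rw [Fintype.expect_eq_sum_div_card]
    simp
    linarith
  · have c1 := r1.closes (Closes.close a d)
    have c3 := r3.closes (Closes.close a c)
    by_contra hcon
    have n1 := lt_of_not_ge fun h => hcon (c1.mono _ _ _ h)
    have n3 := lt_of_not_ge fun h => hcon (c3.mono _ _ _ h)
    simp only [hw.symm d a, hw.symm c b, hw.symm d b, hw.symm c a] at *
    linarith

theorem HasEnds.rotate {l : List (α × α)} {a : α} {L E : List α} (h : HasEnds l (a :: L ++ E)) :
    HasEnds l (L ++ [a] ++ E) :=
  h.perm ((List.perm_append_comm (l₁ := [a])).append_right E)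

theorem gains_four (hw : MetricWeight w) {a b c d : α} {E : List α} {l : List (α × α)}
    (hc : IsShortClosed w [a, b, c, d]) (hl : HasEnds l ([a, b, c, d] ++ E)) :
    Gains w l E (cycleValue w [a, b, c, d]) := by
  have hl' : HasEnds l ([b, c, d, a] ++ E) := hl.rotate
  obtain ⟨-, hch⟩ := hc
  simp only [cycleValue, pathWeight, closingWeight, List.isChain_cons_cons,
    List.getLastD_cons, List.getLastD_nil] at hch ⊢
  obtain ⟨hab, hbc, hcd, -⟩ := hch
  by_cases h1 : Partner l a b ∧ Partner l c d
  · obtain ⟨l1, h3, h4, -, h5⟩ := exists_split w hl h1.1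
    have hn := hl.nodup_left
    simp only [List.nodup_cons, List.mem_cons, not_or] at hn
    obtain ⟨l2, h6, h7, -⟩ := exists_split w h3 (h5 c d (by tauto) (by tauto) h1.2)
    exact ⟨[], l2, h6, ((h4.trans (h7.append_left [(a, b)])).reduces.trans
      ((isBlock_square hw hbc le_rfl le_rfl).reduces l2)).mono (by linarith)⟩
  by_cases h2 : Partner l b c ∧ Partner l d a
  · obtain ⟨l1, h3, h4, -, h5⟩ := exists_split w hl' h2.1
    have hn := hl.nodup_left
    simp only [List.nodup_cons, List.mem_cons, not_or] at hn
    obtain ⟨l2, h6, h7, -⟩ := exists_split w h3 (h5 d a (by tauto) (by tauto) h2.2)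
    exact ⟨[], l2, h6, ((h4.trans (h7.append_left [(b, c)])).reduces.trans
      ((isBlock_square hw hcd hab le_rfl).reduces l2)).mono (by linarith)⟩
  have g1 := gains_one_of_four (L := []) hw hl (by tauto) hab hcd
  have g2 := gains_one_of_four (L := []) hw hl' (by tauto) hbc le_rfl
  by_contra hcon
  have n1 := lt_of_not_ge fun h => hcon (g1.mono h)
  have n2 := lt_of_not_ge fun h => hcon (g2.mono h)
  simp only [altWeight] at n1 n2
  linarith

theorem handles_pentagon_side (hw : MetricWeight w) {a b c d e : α} {E : List α}
    {l : List (α × α)} {v m : ℝ} (hl : HasEnds l ([e, a, b, c, d] ++ E))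
    (hab : Partner l a b) (hcd : Partner l c d) (h1 : m ≤ w e a) (h2 : m ≤ w d e)
    (hv : v ≤ (w e a + w a b + w b c + w c d + w d e) / 4 + m / 2) : Handles w l E v := by
  have hl' : HasEnds l ([a, b, c, d] ++ (e :: E)) :=
    hl.perm (List.perm_middle (l₁ := [a, b, c, d])).symm
  obtain ⟨l1, h3, h4, -, h5⟩ := exists_split w hl' hab
  have hn := hl.nodup_left
  simp only [List.nodup_cons, List.mem_cons, not_or] at hn
  obtain ⟨l2, h6, h7, -⟩ := exists_split w h3 (h5 c d (by tauto) (by tauto) hcd)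
  refine Or.inr ⟨e, [(a, b), (d, c)], l2, isGadget_pentagon hw h1 (hw.symm d e ▸ h2)
    (by rw [hw.symm d e] at hv; exact hv), h6, ?_⟩
  refine ((h4.trans (h7.append_left [(a, b)])).trans
    ((Reach.swap_second (a, b) c d l2).trans (Reach.perm ?_))).mono (by simp)
  exact List.perm_append_comm (l₁ := [(a, b), (d, c)])

theorem handles_pentagon (hw : MetricWeight w) {a b c d e : α} {E : List α} {l : List (α × α)}
    (hc : IsShortClosed w [a, b, c, d, e]) (hl : HasEnds l ([a, b, c, d, e] ++ E)) :
    Handles w l E (cycleValue w [a, b, c, d, e]) := by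
  have hu := hl.partner_unique
  have hs : ∀ x y, Partner l x y → Partner l y x := fun _ _ h => h.symm
  have hb : HasEnds l ([b, c, d, e, a] ++ E) := hl.rotate
  have hc' : HasEnds l ([c, d, e, a, b] ++ E) := hb.rotate
  have hd : HasEnds l ([d, e, a, b, c] ++ E) := hc'.rotate
  have he : HasEnds l ([e, a, b, c, d] ++ E) := hd.rotate
  have hl' : HasEnds l ([b, c, d, e] ++ (a :: E)) :=
    hl.perm (List.perm_middle (l₁ := [b, c, d, e])).symm
  have hl'' : HasEnds l ([a, b, c, d] ++ (e :: E)) := hl.perm (List.Perm.refl _)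
  have drop : ∀ x t, Gains w l (x :: E) t → Gains w l E t := by
    rintro x t ⟨Z, l', h1, h2⟩
    exact ⟨Z ++ [x], l', by simpa using h1, h2⟩
  obtain ⟨-, hch⟩ := hc
  simp only [cycleValue, pathWeight, closingWeight, List.isChain_cons_cons,
    List.getLastD_cons, List.getLastD_nil] at hch ⊢
  obtain ⟨hab, hbc, hcd, hde, -⟩ := hch
  have s := hw.symm
  rcases independent_or_of_five hs hu hl.nodup_left with
    h | h | h | h | h | h | h | h | h | h | h | h
  · have g1 := drop _ _ (gains_two (L := []) hw hl'' h.1)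
    have g2 := drop _ _ (gains_one_of_four (L := []) hw hl' h.2 hbc hde)
    refine Or.inl ?_
    by_contra hcon
    have n1 := lt_of_not_ge fun h => hcon (g1.mono h)
    have n2 := lt_of_not_ge fun h => hcon (g2.mono h)
    simp only [altWeight] at n1 n2
    linarith
  · have g1 := drop _ _ (gains_two (L := []) hw hl' h.1)
    have g2 := drop _ _ (gains_one_of_four (L := []) hw hl'' h.2 hab hcd)
    refine Or.inl ?_
    by_contra hcon
    have n1 := lt_of_not_ge fun h => hcon (g1.mono h)
    have n2 := lt_of_not_ge fun h => hcon (g2.mono h)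
    simp only [altWeight] at n1 n2
    linarith
  · exact handles_pentagon_side hw he h.1 h.2 le_rfl hde (by linarith)
  · exact handles_pentagon_side hw hl h.1 h.2 hab le_rfl (by linarith)
  · exact handles_pentagon_side hw hb h.1 h.2 hbc hab (by linarith)
  · exact handles_pentagon_side hw hc' h.1 h.2 hcd hbc (by linarith)
  · exact handles_pentagon_side hw hd h.1 h.2 hde hcd (by linarith)
  · exact Or.inl (gains_pentagon hw hd h.2.symm h.1 hde (s c d ▸ hcd)
      (by linarith [s c d, s d c]))
  · exact Or.inl (gains_pentagon hw he h.2.symm h.1 le_rfl (s d e ▸ hde)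
      (by linarith [s e d]))
  · exact Or.inl (gains_pentagon hw hl h.2.symm h.1 hab (s e a).le
      (by linarith [s a e]))
  · exact Or.inl (gains_pentagon hw hb h.2.symm h.1 hbc (s a b ▸ hab)
      (by linarith [s b a]))
  · exact Or.inl (gains_pentagon hw hc' h.2.symm h.1 hcd (s b c ▸ hbc)
      (by linarith [s c b]))

theorem handles_cycle (hw : MetricWeight w) {L E : List α} {l : List (α × α)}
    (hc : IsShortClosed w L) (h3 : L.length ≠ 3) (hl : HasEnds l (L ++ E)) :
    Handles w l E (cycleValue w L) := by
  have h3' := hc.1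
  match L, hc, hl with
  | [_, _, _, _], hc, hl => exact Or.inl (gains_four hw hc hl)
  | [_, _, _, _, _], hc, hl => exact handles_pentagon hw hc hl
  | [_, _, _, _, _, _], hc, hl => exact Or.inl (gains_six hw hc hl)
  | _ :: _ :: _ :: _ :: _ :: _ :: _ :: _, hc, hl => exact Or.inl (gains_long hw hc hl)
  | [], _, _ => simp at h3'
  | [_], _, _ => simp at h3'
  | [_, _], _, _ => simp at h3'
  | [_, _, _], _, _ => simp at h3

end Handling

section Triangles

open scoped BigOperators

variable {α : Type*} {w : α → α → ℝ}

theorem HasEnds.even {l : List (α × α)} {E : List α} (h : HasEnds l E) : Even E.length := by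
  rw [← h.1.length_eq, ends, List.length_flatMap]
  simp

theorem HasEnds.eq_nil {l : List (α × α)} (h : HasEnds l []) : l = [] := by
  cases l with
  | nil => rfl
  | cons p l => simpa [ends] using h.1.length_eq

theorem isGadget_self (hw : MetricWeight w) (b : α) : IsGadget w b [] 0 :=
  ⟨Unit, inferInstance, inferInstance, fun _ => b, fun _ => 0, fun _ _ => Reach.refl _,
    fun y => by simpa using div_nonneg (hw.nonneg b y) zero_le_two⟩

theorem IsGadget.exists_le {b : α} {P : List (α × α)} {v : ℝ} (h : IsGadget w b P v) (y y' : α) :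
    ∃ z g, (∀ y, Reach w ((b, y) :: P) [(z, y)] g) ∧
      v + v ≤ (g + w z y / 2) + (g + w z y' / 2) := by
  obtain ⟨ι, _, _, z, g, h1, h2⟩ := h
  have h3 := add_le_add (h2 y) (h2 y')
  rw [← Finset.expect_add_distrib] at h3
  obtain ⟨i, hi⟩ := exists_le_of_le_avg h3
  exact ⟨z i, g i, h1 i, hi⟩

theorem IsGadget.exists_pair_le (hw : MetricWeight w) {b b' : α} {P P' : List (α × α)} {v v' : ℝ}
    (h : IsGadget w b P v) (h' : IsGadget w b' P' v') :
    ∃ z z' g g', (∀ y, Reach w ((b, y) :: P) [(z, y)] g) ∧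
      (∀ y, Reach w ((b', y) :: P') [(z', y)] g') ∧ v + v' ≤ g + g' + w z z' := by
  obtain ⟨ι, _, _, z, g, h1, h2⟩ := h
  obtain ⟨κ, _, _, z', g', h1', h2'⟩ := h'
  have h3 : v ≤ 𝔼 j, 𝔼 i, (g i + w (z i) (z' j) / 2) :=
    Finset.le_expect univ_nonempty fun j _ => h2 (z' j)
  have h4 : v' ≤ 𝔼 i, 𝔼 j, (g' j + w (z' j) (z i) / 2) :=
    Finset.le_expect univ_nonempty fun i _ => h2' (z i)
  rw [Finset.expect_comm] at h4
  have h5 := add_le_add h3 h4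
  rw [← Finset.expect_add_distrib] at h5
  obtain ⟨j, hj⟩ := exists_le_of_le_avg h5
  rw [← Finset.expect_add_distrib] at hj
  obtain ⟨i, hi⟩ := exists_le_of_le_avg hj
  refine ⟨z i, z' j, g i, g' j, h1 i, h1' j, ?_⟩
  rw [hw.symm (z' j)] at hi
  linarith

/-- Two gadgets whose exits are the two ends of a path form a block. -/
theorem IsGadget.isBlock (hw : MetricWeight w) {b b' : α} {P P' : List (α × α)} {v v' : ℝ}
    (h : IsGadget w b P v) (h' : IsGadget w b' P' v') :
    IsBlock w ((b, b') :: (P ++ P')) (v + v') := by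
  have hr : ∀ z z' g g', (∀ y, Reach w ((b, y) :: P) [(z, y)] g) →
      (∀ y, Reach w ((b', y) :: P') [(z', y)] g') →
      Reach w ((b, b') :: (P ++ P')) [(z, z')] (g + g') := fun z z' g g' h1 h1' =>
    (((h1 b').append_right P').trans ((Reach.swap _ _ _).trans
      ((h1' z).trans (Reach.swap _ _ _)))).mono (by simp)
  obtain ⟨z, z', g, g', h1, h1', h2⟩ := h.exists_pair_le hw h'
  have hc := ((hr _ _ _ _ h1 h1').closes (Closes.close z z')).mono _ _ (v + v') (by linarith)
  obtain ⟨ι, _, _, z, g, h1, h2⟩ := h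
  obtain ⟨κ, _, _, z', g', h1', h2'⟩ := h'
  refine ⟨ι × κ, inferInstance, inferInstance, fun q => z q.1, fun q => z' q.2,
    fun q => g q.1 + g' q.2, fun q => hr _ _ _ _ (h1 _) (h1' _), fun y => ?_, hc⟩
  have h3 : ∀ q : ι × κ, g q.1 + g' q.2 + (w (z q.1) y + w (z' q.2) y) / 2 =
      (g q.1 + w (z q.1) y / 2) + (g' q.2 + w (z' q.2) y / 2) := fun q => by ring
  rw [Finset.expect_congr rfl fun q _ => h3 q, Finset.expect_add_distrib,
    ← Finset.univ_product_univ, Finset.expect_product, Finset.expect_product]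
  simpa using add_le_add (h2 y) (h2' y)

theorem exists_merge_gadgets (hw : MetricWeight w) {l : List (α × α)} {b b' : α} {E : List α}
    {P P' : List (α × α)} {v v' : ℝ} (hl : HasEnds l (b :: b' :: E)) (h : IsGadget w b P v)
    (h' : IsGadget w b' P' v') :
    ∃ l', HasEnds l' E ∧ Reduces w (l ++ (P ++ P')) l' (v + v') := by
  by_cases hb : Partner l b b'
  · obtain ⟨l', h1, h2, -⟩ := exists_split w hl hb
    have p : ((b, b') :: l' ++ (P ++ P')).Perm ((b, b') :: (P ++ P') ++ l') :=
      List.Perm.cons _ List.perm_append_comm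
    exact ⟨l', h1, (((h2.append_right _).trans (Reach.perm p)).reduces.trans
      ((h.isBlock hw h').reduces l')).mono (by simp)⟩
  · obtain ⟨l', h1, h2, -⟩ := exists_attach_join w hl hb
    obtain ⟨z, z', g, g', h3, h4, h5⟩ := h.exists_pair_le hw h'
    exact ⟨l', h1, (h2 _ _ _ _ _ _ h3 h4).reduces.mono h5⟩

/-- Joining a gadget with a triangle when none of the paths connects two vertices of the
triangle, and the path at the exit of the gadget does not end in `b` or `c`. -/
theorem exists_merge_gadget_triangle_of_independent (hw : MetricWeight w)
    {l : List (α × α)} {x a b c : α} {E : List α} {P : List (α × α)} {v m : ℝ} (hl : HasEnds l (x :: a :: b :: c :: E))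
    (h : IsGadget w x P v) (hab : ¬ Partner l a b) (hac : ¬ Partner l a c) (hbc : ¬ Partner l b c)
    (hxb : ¬ Partner l x b) (hxc : ¬ Partner l x c) (h1 : m ≤ w a b) (h2 : m ≤ w a c) :
    ∃ l', HasEnds l' E ∧
      Reduces w (l ++ P) l' (v + ((w a b + w b c + w a c) / 4 + m / 2)) := by
  obtain ⟨z, g, h3, h4⟩ := h.exists_le b c
  have eb : HasEnds l (x :: b :: a :: c :: E) := hl.perm ((List.Perm.swap _ _ _).cons _)
  have ec : HasEnds l (x :: c :: a :: b :: E) := hl.perm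
    ((List.perm_append_comm (l₁ := [a, b]) (l₂ := [c])).append_right E |>.cons _)
  obtain ⟨l1, e1, r1, p1⟩ := exists_attach_join w eb hxb
  obtain ⟨l2, e2, r2, p2⟩ := exists_attach_join w ec hxc
  have hba : ¬ Partner l b a := fun h => hab h.symm
  have hca : ¬ Partner l c a := fun h => hac h.symm
  have hcb : ¬ Partner l c b := fun h => hbc h.symm
  obtain ⟨l3, e3, r3, -⟩ := exists_join (w := w) e1 fun h => by have := p1 _ _ h; tauto
  obtain ⟨l4, e4, r4, -⟩ := exists_join (w := w) e2 fun h => by have := p2 _ _ h; tauto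
  have s1 := (by simpa using r1 P [] z b g 0 h3 fun y => Reach.refl _ :
    Reach w (l ++ P) l1 (g + w z b)).reduces.trans r3
  have s2 := (by simpa using r2 P [] z c g 0 h3 fun y => Reach.refl _ :
    Reach w (l ++ P) l2 (g + w z c)).reduces.trans r4
  by_contra hcon
  have n1 := lt_of_not_ge fun h => hcon ⟨_, e3, s1.mono h⟩
  have n2 := lt_of_not_ge fun h => hcon ⟨_, e4, s2.mono h⟩
  have t := hw.tri b z c
  rw [hw.symm b z] at t
  linarith

theorem exists_merge_gadget_triangle (hw : MetricWeight w) {l : List (α × α)} {x a b c : α}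
    {E : List α} {P : List (α × α)} {v m : ℝ} (hl : HasEnds l (x :: a :: b :: c :: E))
    (h : IsGadget w x P v) (hab : ¬ Partner l a b) (hac : ¬ Partner l a c) (hbc : ¬ Partner l b c)
    (h1 : m ≤ w a b) (h2 : m ≤ w a c) (h3 : m ≤ w b c) :
    ∃ l', HasEnds l' E ∧
      Reduces w (l ++ P) l' (v + ((w a b + w b c + w a c) / 4 + m / 2)) := by
  have hu := hl.partner_unique
  have hn := hl.2
  simp only [List.nodup_cons, List.mem_cons, not_or] at hn
  have hba : ¬ Partner l b a := fun h => hab h.symm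
  have hca : ¬ Partner l c a := fun h => hac h.symm
  have hcb : ¬ Partner l c b := fun h => hbc h.symm
  have s := hw.symm
  by_cases hxb : Partner l x b
  · obtain ⟨l', h4, h5⟩ := exists_merge_gadget_triangle_of_independent (a := b) (b := a) (c := c) hw
      (hl.perm ((List.Perm.swap _ _ _).cons _)) h hba hbc hac (by grind) (by grind)
      (s a b ▸ h1) h3
    exact ⟨l', h4, h5.mono (by linarith [s b a])⟩
  by_cases hxc : Partner l x c
  · obtain ⟨l', h4, h5⟩ := exists_merge_gadget_triangle_of_independent (a := c) (b := a) (c := b) hw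
      (hl.perm ((List.perm_append_comm (l₁ := [a, b]) (l₂ := [c])).append_right E |>.cons _))
      h hca hcb hab (by grind) (by grind) (s a c ▸ h2) (s b c ▸ h3)
    exact ⟨l', h4, h5.mono (by linarith [s c a, s c b])⟩
  exact exists_merge_gadget_triangle_of_independent hw hl h hab hac hbc hxb hxc h1 h2

end Triangles

section Prisms

open scoped BigOperators

variable {α : Type*} {w : α → α → ℝ}

theorem reach_prism (hw : MetricWeight w) (a b c a' b' c' : α) :
    Reach w [(a, a'), (b, b'), (c, c')] [(a, b')] (w b c + w a' c') := by
  have p : [(a, a'), (b, b'), (c, c')].Perm [(a, a'), (c, c'), (b, b')] :=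
    (List.Perm.swap _ _ _).cons _
  exact ((((Reach.perm p).trans (Reach.swap_second _ _ _ _)).trans (Reach.join _ _ _ _ _)).trans
    (Reach.join _ _ _ _ _)).mono (by rw [hw.symm b c]; linarith)

theorem isBlock_prism (hw : MetricWeight w) {a b c a' b' c' : α} {m m' : ℝ} (hab : m ≤ w a b)
    (hac : m ≤ w a c) (hbc : m ≤ w b c) (hab' : m' ≤ w a' b') (hac' : m' ≤ w a' c')
    (hbc' : m' ≤ w b' c') :
    IsBlock w [(a, a'), (b, b'), (c, c')] (((w a b + w b c + w a c) / 4 + m / 2) +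
      ((w a' b' + w b' c' + w a' c') / 4 + m' / 2)) := by
  have s := hw.symm
  have q1 : [(a, a'), (b, b'), (c, c')].Perm [(b, b'), (a, a'), (c, c')] := List.Perm.swap _ _ _
  have q2 : [(a, a'), (b, b'), (c, c')].Perm [(b, b'), (c, c'), (a, a')] :=
    List.perm_append_comm (l₁ := [(a, a')])
  have q3 : [(a, a'), (b, b'), (c, c')].Perm [(c, c'), (a, a'), (b, b')] :=
    List.perm_append_comm (l₁ := [(a, a'), (b, b')])
  have q4 : [(a, a'), (b, b'), (c, c')].Perm [(c, c'), (b, b'), (a, a')] :=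
    q3.trans ((List.Perm.swap _ _ _).cons _)
  have q5 : [(a, a'), (b, b'), (c, c')].Perm [(a, a'), (c, c'), (b, b')] :=
    (List.Perm.swap _ _ _).cons _
  have r1 := reach_prism hw a b c a' b' c'
  have r2 := (Reach.perm (w := w) q1).trans (reach_prism hw b a c b' a' c')
  have r3 := (Reach.perm (w := w) q2).trans (reach_prism hw b c a b' c' a')
  have r4 := (Reach.perm (w := w) q3).trans (reach_prism hw c a b c' a' b')
  have r5 := (Reach.perm (w := w) q4).trans (reach_prism hw c b a c' b' a')
  have r6 := (Reach.perm (w := w) q5).trans (reach_prism hw a c b a' c' b')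
  refine ⟨Fin 6, inferInstance, inferInstance, ![a, b, b, c, c, a], ![b', a', c', a', b', c'],
    ![w b c + w a' c', w a c + w b' c', w c a + w b' a', w a b + w c' b', w b a + w c' a',
      w c b + w a' b'], ?_, ?_, ?_⟩
  · intro i
    fin_cases i
    · exact r1
    · exact r2.mono (by simp)
    · exact r3.mono (by simp)
    · exact r4.mono (by simp)
    · exact r5.mono (by simp)
    · exact r6.mono (by simp)
  · intro y
    rw [Fintype.expect_eq_sum_div_card, Fin.sum_univ_six]
    simp only [Matrix.cons_val, Fintype.card_fin, Nat.cast_ofNat]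
    have t1 := hw.tri a y b
    have t2 := hw.tri b y c
    have t3 := hw.tri a y c
    have t4 := hw.tri a' y b'
    have t5 := hw.tri b' y c'
    have t6 := hw.tri a' y c'
    rw [s y] at t1 t2 t3 t4 t5 t6
    rw [s c b, s b' a', s c' b', s b a, s c' a', s c a]
    linarith
  · by_contra hcon
    have n1 := lt_of_not_ge fun h => hcon ((r1.closes (Closes.close _ _)).mono _ _ _ h)
    have n2 := lt_of_not_ge fun h => hcon ((r2.closes (Closes.close _ _)).mono _ _ _ h)
    have n3 := lt_of_not_ge fun h => hcon ((r3.closes (Closes.close _ _)).mono _ _ _ h)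
    have n4 := lt_of_not_ge fun h => hcon ((r4.closes (Closes.close _ _)).mono _ _ _ h)
    have n5 := lt_of_not_ge fun h => hcon ((r5.closes (Closes.close _ _)).mono _ _ _ h)
    have n6 := lt_of_not_ge fun h => hcon ((r6.closes (Closes.close _ _)).mono _ _ _ h)
    have t1 := hw.tri b' a c'
    have t2 := hw.tri a' b c'
    have t3 := hw.tri a' c b'
    have t4 := hw.tri b a' c
    have t5 := hw.tri a b' c
    have t6 := hw.tri a c' b
    rw [s b' a] at t1
    rw [s a' b] at t2
    rw [s a' c] at t3
    rw [s a' c] at t4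
    rw [s b' c] at t5
    rw [s c' b] at t6
    rw [s c a, s b' a'] at n3
    rw [s c' b'] at n4
    rw [s b a, s c' a'] at n5
    rw [s c b] at n6
    linarith

/-- None of the paths connects two vertices of a triangle, and those connecting the triangles
`a b c` and `a' b' c'` connect corresponding vertices. -/
def Aligned (l : List (α × α)) (a b c a' b' c' : α) : Prop :=
  (¬ Partner l a b ∧ ¬ Partner l a c ∧ ¬ Partner l b c) ∧
  (¬ Partner l a' b' ∧ ¬ Partner l a' c' ∧ ¬ Partner l b' c') ∧
  ¬ Partner l a b' ∧ ¬ Partner l a c' ∧ ¬ Partner l b a' ∧ ¬ Partner l b c' ∧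
  ¬ Partner l c a' ∧ ¬ Partner l c b'

theorem Aligned.swap {l : List (α × α)} {a b c a' b' c' : α} (h : Aligned l a b c a' b' c') :
    Aligned l b a c b' a' c' := by
  have hs : ∀ x y, Partner l x y → Partner l y x := fun _ _ h => h.symm
  simp only [Aligned] at *
  grind

theorem Aligned.rotate {l : List (α × α)} {a b c a' b' c' : α} (h : Aligned l a b c a' b' c') :
    Aligned l b c a b' c' a' := by
  have hs : ∀ x y, Partner l x y → Partner l y x := fun _ _ h => h.symm
  simp only [Aligned] at *
  grind

theorem perm_swap_prism (a b c a' b' c' : α) (E : List α) :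
    ([a, b, c, a', b', c'] ++ E).Perm ([b, a, c, b', a', c'] ++ E) :=
  ((List.Perm.swap b a [c]).append (List.Perm.swap b' a' [c'])).append_right E

theorem perm_rotate_prism (a b c a' b' c' : α) (E : List α) :
    ([a, b, c, a', b', c'] ++ E).Perm ([b, c, a, b', c', a'] ++ E) :=
  ((List.perm_append_comm (l₁ := [a]) (l₂ := [b, c])).append
    (List.perm_append_comm (l₁ := [a']) (l₂ := [b', c']))).append_right E

theorem Aligned.exists_join {l : List (α × α)} {a b c a' b' c' : α} {E : List α}
    (h : Aligned l a b c a' b' c') (hl : HasEnds l ([a, b, c, a', b', c'] ++ E))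
    (hP : ¬ (Partner l a a' ∧ Partner l b b' ∧ Partner l c c')) :
    ∃ l', HasEnds l' E ∧ Reduces w l l' (w a b' + w b c + w a' c') := by
  have hs : ∀ x y, Partner l x y → Partner l y x := fun _ _ h => h.symm
  simp only [Aligned] at h
  have e : HasEnds l (a :: b' :: b :: c :: a' :: c' :: E) := hl.perm
    ((List.perm_append_comm (l₁ := [b, c, a']) (l₂ := [b'])).append_right ([c'] ++ E) |>.cons _)
  obtain ⟨l1, e1, r1, p1⟩ := _root_.exists_join (w := w) e (by tauto)
  obtain ⟨l2, e2, r2, p2⟩ := _root_.exists_join (w := w) e1 (by grind)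
  obtain ⟨l3, e3, r3, -⟩ := _root_.exists_join (w := w) e2 (by grind)
  exact ⟨l3, e3, (r1.trans r2).trans r3⟩

theorem Aligned.exists_merge (hw : MetricWeight w) {l : List (α × α)} {a b c a' b' c' : α}
    {E : List α} {m m' : ℝ} (h : Aligned l a b c a' b' c')
    (hl : HasEnds l ([a, b, c, a', b', c'] ++ E)) (hab : m ≤ w a b)
    (hac : m ≤ w a c) (hbc : m ≤ w b c) (hab' : m' ≤ w a' b') (hac' : m' ≤ w a' c')
    (hbc' : m' ≤ w b' c') :
    ∃ l', HasEnds l' E ∧ Reduces w l l' (((w a b + w b c + w a c) / 4 + m / 2) +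
      ((w a' b' + w b' c' + w a' c') / 4 + m' / 2)) := by
  by_cases hP : Partner l a a' ∧ Partner l b b' ∧ Partner l c c'
  · have hn := hl.nodup_left
    simp only [List.nodup_cons, List.mem_cons, not_or] at hn
    have e : HasEnds l (a :: a' :: b :: b' :: c :: c' :: E) := by
      refine hl.perm (List.Perm.cons _ ?_)
      refine ((List.perm_append_comm (l₁ := [b, c]) (l₂ := [a'])).append_right
        ([b', c'] ++ E)).trans (List.Perm.cons _ (List.Perm.cons _ (List.Perm.swap _ _ _)))
    obtain ⟨l1, e1, r1, -, p1⟩ := exists_split w e hP.1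
    have hbb := p1 b b' (by tauto) (by tauto) hP.2.1
    obtain ⟨l2, e2, r2, -, p2⟩ := exists_split w e1 hbb
    have hcc := p2 c c' (by tauto) (by tauto) (p1 c c' (by tauto) (by tauto) hP.2.2)
    obtain ⟨l3, e3, r3, -⟩ := exists_split w e2 hcc
    refine ⟨l3, e3, ((r1.trans ((r2.trans (r3.append_left [(b, b')])).append_left
      [(a, a')])).reduces.trans
      ((isBlock_prism hw hab hac hbc hab' hac' hbc').reduces l3)).mono (by linarith)⟩
  have s := hw.symm
  have l1 := hl.perm (perm_swap_prism _ _ _ _ _ _ _)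
  have l2 := hl.perm (perm_rotate_prism _ _ _ _ _ _ _)
  have l3 := l2.perm (perm_rotate_prism _ _ _ _ _ _ _)
  have l4 := l1.perm (perm_rotate_prism _ _ _ _ _ _ _)
  have l5 := l4.perm (perm_rotate_prism _ _ _ _ _ _ _)
  obtain ⟨_, e0, r0⟩ := h.exists_join (w := w) hl hP
  obtain ⟨_, e1, r1⟩ := h.swap.exists_join (w := w) l1 (by tauto)
  obtain ⟨_, e2, r2⟩ := h.rotate.exists_join (w := w) l2 (by tauto)
  obtain ⟨_, e3, r3⟩ := h.rotate.rotate.exists_join (w := w) l3 (by tauto)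
  obtain ⟨_, e4, r4⟩ := h.swap.rotate.exists_join (w := w) l4 (by tauto)
  obtain ⟨_, e5, r5⟩ := h.swap.rotate.rotate.exists_join (w := w) l5 (by tauto)
  by_contra hcon
  have n0 := lt_of_not_ge fun h => hcon ⟨_, e0, r0.mono h⟩
  have n1 := lt_of_not_ge fun h => hcon ⟨_, e1, r1.mono h⟩
  have n2 := lt_of_not_ge fun h => hcon ⟨_, e2, r2.mono h⟩
  have n3 := lt_of_not_ge fun h => hcon ⟨_, e3, r3.mono h⟩
  have n4 := lt_of_not_ge fun h => hcon ⟨_, e4, r4.mono h⟩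
  have n5 := lt_of_not_ge fun h => hcon ⟨_, e5, r5.mono h⟩
  have t1 := hw.tri b' a c'
  have t2 := hw.tri a' b c'
  have t3 := hw.tri a' c b'
  have t4 := hw.tri b a' c
  have t5 := hw.tri a b' c
  have t6 := hw.tri a c' b
  linarith [s b' a, s a' b, s a' c, s b' c, s c' b, s b' a', s c' b', s c' a', s c a, s c b,
    s b a]

/-- Three vertices satisfying `Q` can be reordered in such a way that `P` matches each of `a, b, c`
with the corresponding vertex or with none of them. -/
theorem exists_aligned {P : α → α → Prop} (hs : ∀ a b, P a b → P b a)
    (hu : ∀ a b c, P a b → P a c → b = c) {Q : α → α → α → Prop}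
    (hQ : ∀ x y z, Q x y z → Q y x z) (hQ' : ∀ x y z, Q x y z → Q y z x) {a b c a' b' c' : α}
    (h : Q a' b' c') (hn : [a, b, c].Nodup) (hn' : [a', b', c'].Nodup) :
    ∃ x y z, Q x y z ∧ ¬ P a y ∧ ¬ P a z ∧ ¬ P b x ∧ ¬ P b z ∧ ¬ P c x ∧ ¬ P c y := by
  have q1 := hQ _ _ _ h
  have q2 := hQ' _ _ _ h
  have q3 := hQ' _ _ _ q2
  have q4 := hQ' _ _ _ q1
  have q5 := hQ' _ _ _ q4
  simp only [List.nodup_cons, List.mem_cons, not_or] at hn hn'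
  by_contra hcon
  have n0 := fun h' => hcon ⟨_, _, _, h, h'⟩
  have n1 := fun h' => hcon ⟨_, _, _, q1, h'⟩
  have n2 := fun h' => hcon ⟨_, _, _, q2, h'⟩
  have n3 := fun h' => hcon ⟨_, _, _, q3, h'⟩
  have n4 := fun h' => hcon ⟨_, _, _, q4, h'⟩
  have n5 := fun h' => hcon ⟨_, _, _, q5, h'⟩
  clear hcon q1 q2 q3 q4 q5
  grind

theorem exists_merge_triangles (hw : MetricWeight w) {l : List (α × α)} {a b c a' b' c' : α}
    {E : List α} {m m' : ℝ} (hl : HasEnds l ([a, b, c, a', b', c'] ++ E))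
    (h : ¬ Partner l a b ∧ ¬ Partner l a c ∧ ¬ Partner l b c)
    (h' : ¬ Partner l a' b' ∧ ¬ Partner l a' c' ∧ ¬ Partner l b' c') (hab : m ≤ w a b)
    (hac : m ≤ w a c) (hbc : m ≤ w b c) (hab' : m' ≤ w a' b') (hac' : m' ≤ w a' c')
    (hbc' : m' ≤ w b' c') :
    ∃ l', HasEnds l' E ∧ Reduces w l l' (((w a b + w b c + w a c) / 4 + m / 2) +
      ((w a' b' + w b' c' + w a' c') / 4 + m' / 2)) := by
  have hs : ∀ x y, Partner l x y → Partner l y x := fun _ _ h => h.symm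
  have hn := hl.nodup_left
  obtain ⟨x, y, z, ⟨q1, q2, q3, q4, q5, q6⟩, q7⟩ := exists_aligned hs hl.partner_unique
    (Q := fun x y z => [a', b', c'].Perm [x, y, z] ∧
      w a' b' + w b' c' + w a' c' = w x y + w y z + w x z ∧ m' ≤ w x y ∧ m' ≤ w x z ∧
      m' ≤ w y z ∧ ¬ Partner l x y ∧ ¬ Partner l x z ∧ ¬ Partner l y z)
    (fun x y z ⟨h1, h2, h3, h4, h5, h6, h7, h8⟩ => ⟨h1.trans (List.Perm.swap _ _ _),
      by linarith [hw.symm y x], hw.symm y x ▸ h3, h5, h4, fun h => h6 h.symm, h8, h7⟩)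
    (fun x y z ⟨h1, h2, h3, h4, h5, h6, h7, h8⟩ =>
      ⟨h1.trans (List.perm_append_comm (l₁ := [x])), by linarith [hw.symm y x, hw.symm z x], h5,
        hw.symm y x ▸ h3, hw.symm z x ▸ h4, h8, fun h => h6 h.symm, fun h => h7 h.symm⟩)
    ⟨List.Perm.refl _, rfl, hab', hac', hbc', h'⟩
    (a := a) (b := b) (c := c) (by simp only [List.nodup_cons, List.mem_cons] at *; tauto)
    (by simp only [List.nodup_cons, List.mem_cons] at *; tauto)
  rw [q2]
  exact Aligned.exists_merge hw ⟨h, q6, q7⟩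
    (hl.perm ((q1.append_left [a, b, c]).append_right E)) hab hac hbc q3 q4 q5

end Prisms

section Cycles

variable {α : Type*} {w : α → α → ℝ}

/-- Total list of paths of a list of gadgets. -/
def gadgetPaths (G : List (α × List (α × α) × ℝ)) : List (α × α) :=
  (G.map fun x => x.2.1).flatten

/-- Total value of a list of gadgets. -/
def gadgetValue (G : List (α × List (α × α) × ℝ)) : ℝ := (G.map fun x => x.2.2).sum

theorem Handles.exists_gadgets (hw : MetricWeight w) {l : List (α × α)} {E : List α} {v : ℝ}
    (h : Handles w l E v) : ∃ (G : List (α × List (α × α) × ℝ)) (l' : List (α × α)) (u : ℝ),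
      (∀ x ∈ G, IsGadget w x.1 x.2.1 x.2.2) ∧ HasEnds l' (G.map Prod.fst ++ E) ∧
      Reduces w l (l' ++ gadgetPaths G) u ∧ v ≤ u + gadgetValue G := by
  rcases h with ⟨Z, l', h1, h2⟩ | ⟨b, P, l', h1, h2, h3⟩
  · refine ⟨Z.map fun z => (z, [], 0), l', v, ?_, ?_, ?_, ?_⟩
    · simp only [List.mem_map, forall_exists_index, and_imp]
      rintro _ z - rfl
      exact isGadget_self hw z
    · rw [List.map_map]
      simpa [Function.comp_def] using h1
    · simpa [gadgetPaths, Function.comp_def] using h2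
    · simp [gadgetValue, Function.comp_def]
  · exact ⟨[(b, P, v)], l', 0, by simpa using h1, h2, by simpa [gadgetPaths] using h3.reduces,
      by simp [gadgetValue]⟩

theorem handles_or (hw : MetricWeight w) {L E : List α} {l : List (α × α)}
    (hc : IsShortClosed w L) (hl : HasEnds l (L ++ E)) :
    Handles w l E (cycleValue w L) ∨ ∃ a b c m, L = [a, b, c] ∧
      (¬ Partner l a b ∧ ¬ Partner l a c ∧ ¬ Partner l b c) ∧ (m ≤ w a b ∧ m ≤ w a c ∧ m ≤ w b c) ∧
      cycleValue w L ≤ (w a b + w b c + w a c) / 4 + m / 2 := by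
  by_cases h3 : L.length ≠ 3
  · exact Or.inl (handles_cycle hw hc h3 hl)
  obtain ⟨a, b, c, rfl⟩ := List.length_eq_three.1 (not_not.1 h3)
  have hch := hc.2
  simp only [cycleValue, pathWeight, closingWeight, List.isChain_cons_cons,
    List.getLastD_cons, List.getLastD_nil] at hch ⊢
  obtain ⟨h1, h2, -⟩ := hch
  have s := hw.symm
  have ea : HasEnds l (b :: c :: a :: E) := hl.rotate
  have eb : HasEnds l (c :: a :: b :: E) := HasEnds.rotate (L := [c, a]) ea
  have key : ∀ x y z, HasEnds l (x :: y :: z :: E) → w c a ≤ w z x → w c a ≤ w z y →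
      (w a b + w b c + w c a = w x y + w y z + w z x) → Partner l x y →
      Handles w l E ((w a b + (w b c + 0) + w c a) / 4 + w c a / 2) := by
    intro x y z h h1 h2 h3 h4
    obtain ⟨l', h5, h6, -⟩ := exists_split w h h4
    exact Or.inr ⟨z, [(x, y)], l', isGadget_triangle hw h1 h2 (by linarith [s y z]), h5,
      h6.trans (Reach.perm (List.perm_append_comm (l₁ := [(x, y)]))) |>.mono (by simp)⟩
  by_cases p1 : Partner l a b
  · exact Or.inl (key _ _ _ hl le_rfl (s b c ▸ h2) rfl p1)
  by_cases p2 : Partner l b c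
  · exact Or.inl (key _ _ _ ea h1 (s c a).le (by ring) p2)
  by_cases p3 : Partner l c a
  · exact Or.inl (key _ _ _ eb h2 (s a b ▸ h1) (by ring) p3)
  exact Or.inr ⟨a, b, c, w c a, rfl, ⟨p1, fun h => p3 h.symm, p2⟩, ⟨h1, (s c a).le, h2⟩,
    by linarith [s c a]⟩

theorem reduces_of_gadgets (hw : MetricWeight w) : ∀ (G : List (α × List (α × α) × ℝ))
    (l : List (α × α)), (∀ x ∈ G, IsGadget w x.1 x.2.1 x.2.2) → HasEnds l (G.map Prod.fst) →
    Reduces w (l ++ gadgetPaths G) [] (gadgetValue G)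
  | [], l, _, hl => by
    rw [hl.eq_nil]
    simpa [gadgetPaths, gadgetValue] using (Reach.refl (w := w) []).reduces
  | [x], _, _, hl => by simpa using hl.even
  | x :: y :: G, l, hG, hl => by
    obtain ⟨l', h1, h2⟩ := exists_merge_gadgets hw hl (hG x (by simp)) (hG y (by simp))
    have h3 := reduces_of_gadgets hw G l' (fun z hz => hG z (by simp [hz])) h1
    have h4 := h2.append_right (gadgetPaths G)
    simp only [gadgetPaths, gadgetValue, List.map_cons, List.flatten_cons, List.append_assoc,
      List.sum_cons] at *
    exact (h4.trans h3).mono (by linarith)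

theorem reduces_of_cycles (hw : MetricWeight w) (T : List (List α))
    (G : List (α × List (α × α) × ℝ)) (l : List (α × α)) (hT : ∀ L ∈ T, IsShortClosed w L)
    (hG : ∀ x ∈ G, IsGadget w x.1 x.2.1 x.2.2)
    (hl : HasEnds l (G.map Prod.fst ++ T.flatten)) :
    Reduces w (l ++ gadgetPaths G) [] ((T.map (cycleValue w)).sum + gadgetValue G) := by
  induction hn : T.length using Nat.strong_induction_on generalizing T G l with | _ n ih
  have step : ∀ (L : List α) (T' : List (List α)), T.Perm (L :: T') →
      Handles w l (G.map Prod.fst ++ T'.flatten) (cycleValue w L) →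
      Reduces w (l ++ gadgetPaths G) [] ((T.map (cycleValue w)).sum + gadgetValue G) := by
    intro L T' hp h
    have hlt : T'.length < n := by simp [← hn, hp.length_eq]
    obtain ⟨G', l', u, h1, h2, h3, h4⟩ := h.exists_gadgets hw
    have h5 := ih _ hlt T' (G' ++ G) l'
      (fun L' h => hT _ (hp.mem_iff.2 (List.mem_cons_of_mem _ h)))
      (fun x hx => (List.mem_append.1 hx).elim (h1 x) (hG x)) (by simpa using h2) rfl
    have h6 := h3.append_right (gadgetPaths G)
    rw [(hp.map (cycleValue w)).sum_eq]
    simp only [gadgetPaths, gadgetValue, List.map_append, List.flatten_append, List.append_assoc,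
      List.sum_append, List.map_cons, List.sum_cons] at *
    exact (h6.trans h5).mono (by linarith)
  have ordered : ∀ (L : List α) (T' : List (List α)), T.Perm (L :: T') →
      HasEnds l (L ++ (G.map Prod.fst ++ T'.flatten)) := fun L T' hp =>
    hl.perm ((hp.flatten.append_left _).trans (by
      rw [List.flatten_cons, ← List.append_assoc, ← List.append_assoc]
      exact List.perm_append_comm.append_right _))
  rcases T with _ | ⟨L, T⟩
  · simpa using reduces_of_gadgets hw G l hG (by simpa using hl)
  · rcases handles_or hw (hT L (by simp)) (ordered L T (List.Perm.refl _)) with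
      h | ⟨a, b, c, m, rfl, hp, ⟨hab, hac, hbc⟩, hv⟩
    · exact step L T (List.Perm.refl _) h
    rcases G with _ | ⟨x, G⟩
    · rcases T with _ | ⟨L', T⟩
      · simpa [Nat.even_iff] using hl.even
      · have hL : ([a, b, c] :: L' :: T).Perm (L' :: [a, b, c] :: T) := List.Perm.swap _ _ _
        rcases handles_or hw (hT L' (by simp)) (ordered L' ([a, b, c] :: T) hL) with
          h | ⟨a', b', c', m', rfl, hp', ⟨hab', hac', hbc'⟩, hv'⟩
        · exact step L' _ hL h
        obtain ⟨l', h1, h2⟩ := exists_merge_triangles (E := T.flatten) hw hl hp hp' hab hac hbc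
          hab' hac' hbc'
        have h3 := ih T.length (by grind) T [] l' (fun z hz => hT z (by simp [hz]))
          (by simp) h1 rfl
        simp only [gadgetPaths, gadgetValue, List.map_cons, List.flatten_cons,
          List.sum_cons, List.append_nil, List.flatten_nil, List.map_nil, List.sum_nil] at *
        exact (h2.trans h3).mono (by linarith)
    · have h1 : HasEnds l (x.1 :: a :: b :: c :: (G.map Prod.fst ++ T.flatten)) :=
        (ordered _ T (List.Perm.refl _)).perm
          (List.perm_append_comm (l₁ := [a, b, c]) (l₂ := [x.1]) |>.append_right _)
      obtain ⟨l', h1, h2⟩ := exists_merge_gadget_triangle hw h1 (hG x (by simp)) hp.1 hp.2.1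
        hp.2.2 hab hac hbc
      have h3 := ih T.length (by grind) T G l' (fun z hz => hT z (by simp [hz]))
        (fun z hz => hG z (by simp [hz])) h1 rfl
      have h4 := h2.append_right (gadgetPaths G)
      simp only [gadgetPaths, gadgetValue, List.map_cons, List.flatten_cons, List.append_assoc,
        List.sum_cons] at *
      exact (h4.trans h3).mono (by linarith)

theorem closes_of_cycles (hw : MetricWeight w) (T : List (List α)) (l : List (α × α))
    (hT : ∀ L ∈ T, IsShortClosed w L) (hl : HasEnds l T.flatten) :
    Closes w l (T.map (cycleValue w)).sum := by
  have := reduces_of_cycles hw T [] l hT (by simp) hl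
  exact Reduces.closes hw (by simpa [gadgetPaths, gadgetValue] using this)

end Cycles

section Connecting

variable {α : Type*} {w : α → α → ℝ}

/-- `p` consists of the first and the last vertex of `L`. -/
def HasEndpoints (L : List α) (p : α × α) : Prop := L.head? = some p.1 ∧ L.getLast? = some p.2

theorem HasEndpoints.closingWeight_eq {L : List α} {a b : α} (h : HasEndpoints L (a, b)) :
    closingWeight w L = w b a := by
  obtain ⟨h1, h2⟩ := h
  cases L with
  | nil => simp at h1
  | cons x L =>
    simp only [List.head?_cons, Option.some.injEq] at h1
    rw [List.getLast?_cons, Option.some.injEq] at h2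
    subst h1
    simp only [closingWeight, List.getLastD_eq_getLast?]
    rw [h2]

theorem pathWeight_append : ∀ {L L' : List α} {a b c d : α}, HasEndpoints L (a, b) →
    HasEndpoints L' (c, d) → pathWeight w (L ++ L') = pathWeight w L + pathWeight w L' + w b c
  | [], _, _, _, _, _, h, _ => by simp [HasEndpoints] at h
  | [x], [], _, _, _, _, _, h' => by simp [HasEndpoints] at h'
  | [x], y :: L', a, b, c, d, h, h' => by
    simp only [HasEndpoints, List.head?_cons, Option.some.injEq, List.getLast?_singleton] at h h'
    simp only [List.singleton_append, pathWeight, h.2, h'.1]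
    ring
  | x :: y :: L, L', a, b, c, d, h, h' => by
    have := pathWeight_append (L := y :: L) (a := y) (b := b)
      ⟨rfl, by simpa [HasEndpoints] using h.2⟩ h'
    simp only [List.cons_append, pathWeight] at this ⊢
    linarith

theorem pathWeight_reverse (hw : MetricWeight w) : ∀ L : List α,
    pathWeight w L.reverse = pathWeight w L
  | [] => rfl
  | [_] => rfl
  | x :: y :: L => by
    have h : HasEndpoints (y :: L).reverse ((y :: L).getLast (by simp), y) :=
      ⟨by rw [List.head?_reverse]; exact List.getLast?_eq_some_getLast _, by simp⟩
    rw [List.reverse_cons, pathWeight_append (c := x) (d := x) h ⟨rfl, rfl⟩,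
      pathWeight_reverse hw (y :: L)]
    simp only [pathWeight, hw.symm y x]
    ring

theorem Closes.exists_cycle (hw : MetricWeight w) {l : List (α × α)} {v : ℝ}
    (h : Closes w l v) : ∀ ps : List (List α), List.Forall₂ HasEndpoints ps l →
      ∃ C : List α, C.Perm ps.flatten ∧
        (ps.map (pathWeight w)).sum + v ≤ pathWeight w C + closingWeight w C := by
  induction h with
  | nil =>
    intro ps hps
    cases hps
    exact ⟨[], by simp, by simp [pathWeight, closingWeight]⟩
  | close a b =>
    rintro ps (_ | ⟨h, _ | _⟩)
    rename_i L
    exact ⟨L, by simp, by simp [h.closingWeight_eq, hw.symm b a]⟩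
  | join a b c d l v _ ih =>
    rintro ps (_ | ⟨h, _ | ⟨h', hps⟩⟩)
    rename_i L L' ps
    obtain ⟨C, h1, h2⟩ := ih ((L ++ L') :: ps) (.cons (by
      simp only [HasEndpoints] at *
      simp [List.head?_append, List.getLast?_append, h, h']) hps)
    refine ⟨C, by simpa using h1, ?_⟩
    simp only [List.map_cons, List.sum_cons, pathWeight_append h h'] at *
    linarith
  | swap a b l v _ ih =>
    rintro ps (_ | ⟨h, hps⟩)
    rename_i L ps
    obtain ⟨C, h1, h2⟩ := ih (L.reverse :: ps) (.cons (by
      simp only [HasEndpoints] at *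
      simp [h]) hps)
    refine ⟨C, h1.trans ?_, by simpa [pathWeight_reverse hw] using h2⟩
    simpa using (List.reverse_perm L).append_right ps.flatten
  | perm l l' v hp _ ih =>
    intro ps hps
    obtain ⟨qs, h1, h2⟩ : Relation.Comp List.Perm (List.Forall₂ HasEndpoints) ps l := by
      rw [← List.forall₂_comp_perm_eq_perm_comp_forall₂]
      exact ⟨l', hps, hp.symm⟩
    obtain ⟨C, h3, h4⟩ := ih qs h2
    exact ⟨C, h3.trans h1.symm.flatten, by rwa [(h1.map _).sum_eq]⟩
  | mono l v v' hv _ ih =>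
    intro ps hps
    obtain ⟨C, h1, h2⟩ := ih ps hps
    exact ⟨C, h1, by linarith⟩

theorem exists_closes_of_closing (hw : MetricWeight w) : ∀ T : List (List α), (∀ L ∈ T, L ≠ []) →
    ∃ bs : List (List (α × α) × ℝ), (∀ b ∈ bs, IsBlock w b.1 b.2) ∧
      List.Forall₂ HasEndpoints T (blockPaths bs) ∧
      blockValue bs = (T.map (closingWeight w)).sum / 2
  | [], _ => ⟨[], by simp, by simp [blockPaths], by simp [blockValue]⟩
  | L :: T, h => by
    obtain ⟨bs, h1, h2, h3⟩ := exists_closes_of_closing hw T fun L hL => h L (by simp [hL])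
    have hL := h L (by simp)
    have he : HasEndpoints L (L.head hL, L.getLast hL) :=
      ⟨List.head?_eq_some_head hL, List.getLast?_eq_some_getLast hL⟩
    refine ⟨([(L.head hL, L.getLast hL)], closingWeight w L / 2) :: bs, ?_, ?_, ?_⟩
    · intro b hb
      rcases List.mem_cons.1 hb with rfl | hb
      · rw [he.closingWeight_eq, hw.symm]
        exact isBlock_singleton hw _ _
      · exact h1 b hb
    · exact List.Forall₂.cons he (by simpa [blockPaths] using h2)
    · simp only [blockValue, List.map_cons, List.sum_cons] at *
      linarith

/-- The sum of `w v (σ v)` over a cycle of `σ`. -/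
theorem sum_map_eq_of_isChain {σ : α → α} : ∀ (a : α) (L : List α),
    (a :: L).IsChain (fun x y => σ x = y) →
    ((a :: L).map fun v => w v (σ v)).sum =
      pathWeight w (a :: L) + w (L.getLastD a) (σ (L.getLastD a))
  | a, [], _ => by simp [pathWeight]
  | a, b :: L, h => by
    rw [List.isChain_cons_cons] at h
    have := sum_map_eq_of_isChain b L h.2
    rw [List.map_cons, List.sum_cons, this, pathWeight, List.getLastD_cons, h.1]
    ring

theorem exists_orbit [Finite α] {σ : Equiv.Perm α} (y : α) : ∃ L : List α,
    L.Nodup ∧ L.IsChain (fun u v => σ u = v) ∧ HasEndpoints L (σ y, y) ∧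
      (∀ z, z ∈ L ↔ σ z ∈ L) ∧ ∀ S : Finset α, y ∈ S → (∀ v ∈ S, σ v ∈ S) → ∀ v ∈ L, v ∈ S := by
  have hx : σ y ∈ Function.periodicPts σ := σ.injective.mem_periodicPts _
  have hk := Function.minimalPeriod_pos_of_mem_periodicPts hx
  have hper : σ^[Function.minimalPeriod σ (σ y)] (σ y) = σ y := Function.iterate_minimalPeriod
  have hnd := Function.nodup_periodicOrbit (f := σ) (x := σ y)
  have hmem := fun z => Function.mem_periodicOrbit_iff (f := σ) (y := z) hx
  simp only [Function.periodicOrbit_def, Cycle.nodup_coe_iff, Cycle.mem_coe_iff] at hnd hmem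
  set k := Function.minimalPeriod σ (σ y)
  refine ⟨(List.range k).map fun i => σ^[i] (σ y), hnd, ?_, ⟨?_, ?_⟩, fun z => ?_, ?_⟩
  · rw [List.isChain_map, List.isChain_range]
    intro m _
    exact (Function.iterate_succ_apply' σ m (σ y)).symm
  · rw [List.head?_map, List.head?_range, if_neg hk.ne']
    rfl
  · rw [List.getLast?_map, List.getLast?_range, if_neg hk.ne']
    refine congrArg some (σ.injective ?_)
    rw [← Function.iterate_succ_apply' σ (k - 1) (σ y), Nat.succ_eq_add_one,
      Nat.sub_add_cancel hk, hper]
  · rw [hmem, hmem]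
    constructor
    · rintro ⟨m, rfl⟩
      exact ⟨m + 1, Function.iterate_succ_apply' σ m (σ y)⟩
    · rintro ⟨m, hm⟩
      refine ⟨m + (k - 1), σ.injective ?_⟩
      rw [← Function.iterate_succ_apply' σ, ← hm, Nat.succ_eq_add_one, add_assoc,
        Nat.sub_add_cancel hk, Function.iterate_add_apply, hper]
  · intro S hy hS v hv
    obtain ⟨m, -, rfl⟩ := List.mem_map.1 hv
    clear hv
    induction m with
    | zero => exact hS y hy
    | succ m ih =>
      rw [Function.iterate_succ_apply']
      exact hS _ ih

theorem exists_cycle_decomposition [Finite α] [DecidableEq α] {σ : Equiv.Perm α}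
    (h1 : ∀ v, σ v ≠ v) (h2 : ∀ v, σ (σ v) ≠ v) (S : Finset α) (hS : ∀ v ∈ S, σ v ∈ S) :
    ∃ T : List (List α), T.flatten.Perm S.toList ∧ ∀ L ∈ T, IsShortClosed w L ∧
      (L.map fun v => w v (σ v)).sum = pathWeight w L + closingWeight w L := by
  induction S using Finset.strongInduction with
  | H S ih =>
    rcases S.eq_empty_or_nonempty with rfl | hne
    · exact ⟨[], by simp, by simp⟩
    obtain ⟨y, hy, hmin⟩ := S.exists_min_image (fun v => w v (σ v)) hne
    obtain ⟨L, hnd, hch, hend, hmem, hsub⟩ := exists_orbit (σ := σ) y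
    have hLS := hsub S hy hS
    have hyL : y ∈ L := List.mem_of_getLast? hend.2
    obtain ⟨T, hT, hT'⟩ := ih (S \ L.toFinset)
      (Finset.ssubset_iff_subset_ne.2 ⟨Finset.sdiff_subset, fun h => by
        have := h.symm ▸ hy
        simp [hyL] at this⟩)
      (fun v hv => by
        simp only [Finset.mem_sdiff, List.mem_toFinset] at hv ⊢
        exact ⟨hS v hv.1, fun h => hv.2 ((hmem v).2 h)⟩)
    refine ⟨L :: T, ?_, List.forall_mem_cons.2 ⟨⟨⟨?_, ?_⟩, ?_⟩, hT'⟩⟩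
    · have hTm : ∀ v, v ∈ T.flatten ↔ v ∈ S ∧ v ∉ L := fun v => by
        rw [hT.mem_iff]; simp
      have hTn : T.flatten.Nodup := hT.nodup_iff.2 (Finset.nodup_toList _)
      rw [List.flatten_cons, List.perm_ext_iff_of_nodup _ (Finset.nodup_toList _)]
      · intro v
        rw [List.mem_append, hTm, Finset.mem_toList]
        have := hLS v
        tauto
      · refine List.nodup_append'.2 ⟨hnd, hTn, fun v hv hv' => ((hTm v).1 hv').2 hv⟩
    · obtain ⟨e1, e2⟩ := hend
      match L, hch, e1, e2 with
      | [], _, e1, _ => simp at e1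
      | [a], _, e1, e2 =>
        simp only [List.head?_cons, List.getLast?_singleton, Option.some.injEq] at e1 e2
        exact absurd (e1.symm.trans e2) (h1 y)
      | [a, b], hch, e1, e2 =>
        simp only [List.head?_cons, Option.some.injEq] at e1
        have e2 : b = y := by simpa using e2
        have e3 : σ a = b := by simpa using hch
        exact absurd (by rw [← e1, e3, e2]) (h2 y)
      | a :: b :: c :: L, _, _, _ => simp
    · rw [hend.closingWeight_eq]
      refine List.IsChain.imp_of_mem_imp (R := fun u v => σ u = v) ?_ hch
      rintro a b ha - rfl
      exact hmin a (hLS a ha)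
    · rw [hend.closingWeight_eq]
      match L, hch, hend with
      | [], _, e => simp [HasEndpoints] at e
      | a :: L, hch, e =>
        have : L.getLastD a = y := by
          have := e.2
          rw [List.getLast?_cons, Option.some.injEq] at this
          rw [List.getLastD_eq_getLast?]
          exact this
        rw [sum_map_eq_of_isChain a L hch, this]

theorem pathWeight_ofFn : ∀ (k : ℕ) (f : Fin (k + 1) → α),
    pathWeight w (List.ofFn f) = ∑ j : Fin k, w (f j.castSucc) (f j.succ)
  | 0, f => by simp [pathWeight]
  | k + 1, f => by
    have := pathWeight_ofFn k (fun j => f j.succ)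
    rw [List.ofFn_succ, Fin.sum_univ_succ]
    rw [List.ofFn_succ] at this ⊢
    rw [pathWeight, this]
    simp

end Connecting

theorem exists_hamW_eq {n : ℕ} {w : Fin n → Fin n → ℝ} {C : List (Fin n)}
    (hC : C.Perm Finset.univ.toList) :
    ∃ H : Fin n ≃ Fin n, hamW w H = pathWeight w C + closingWeight w C := by
  have hlen : C.length = n := by simpa using hC.length_eq
  have hnd : C.Nodup := hC.nodup_iff.2 (Finset.nodup_toList _)
  obtain ⟨f, rfl⟩ : ∃ f : Fin n → Fin n, C = List.ofFn f :=
    ⟨fun i => C.get (i.cast hlen.symm), by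
      apply List.ext_get <;> simp [hlen]⟩
  refine ⟨Equiv.ofBijective f (Finite.injective_iff_bijective.1 (List.nodup_ofFn.1 hnd)), ?_⟩
  cases n with
  | zero => simp [hamW, pathWeight, closingWeight]
  | succ k =>
    have hend : HasEndpoints (List.ofFn f) (f 0, f (Fin.last k)) := by
      constructor
      · simp [List.ofFn_succ]
      · rw [List.ofFn_succ']; simp
    rw [hend.closingWeight_eq, pathWeight_ofFn, hamW, Fin.sum_univ_castSucc]
    simp

/-- The edges of a perfect matching `M`, regarded as paths, can be connected to a cycle. -/
theorem exists_cycle_of_matching {n p : ℕ} {w : Fin n → Fin n → ℝ} (hw : MetricWeight w)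
    (M : Fin p × Fin 2 ≃ Fin n) {T : List (List (Fin n))} (hT : ∀ L ∈ T, IsShortClosed w L)
    (hflat : T.flatten.Perm Finset.univ.toList) :
    ∃ C : List (Fin n), C.Perm Finset.univ.toList ∧
      matchW w (fun q => M q) + (T.map (cycleValue w)).sum ≤
        pathWeight w C + closingWeight w C := by
  set l := (List.finRange p).map fun i => (M (i, 0), M (i, 1)) with hl
  set ps := (List.finRange p).map fun i => [M (i, 0), M (i, 1)] with hps
  have hends : ps.flatten = ends l := by
    rw [hps, hl, ends, List.flatMap_map, List.flatMap]
  have huniv : (ends l).Perm Finset.univ.toList := by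
    rw [List.perm_ext_iff_of_nodup _ (Finset.nodup_toList _)]
    · intro v
      obtain ⟨⟨i, j⟩, rfl⟩ := M.surjective v
      fin_cases j <;> simp [ends, hl]
    · rw [← hends, hps, List.nodup_flatten]
      refine ⟨by simp, ?_⟩
      rw [List.pairwise_map]
      refine (List.nodup_finRange p).imp ?_
      intro i j hij
      simp [hij.symm]
  obtain ⟨C, h1, h2⟩ := (closes_of_cycles hw T l hT
    ⟨huniv.trans hflat.symm, hflat.nodup_iff.2 (Finset.nodup_toList _)⟩).exists_cycle hw ps (by
      rw [hps, hl, List.forall₂_map_left_iff, List.forall₂_map_right_iff, List.forall₂_same]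
      exact fun i _ => ⟨rfl, rfl⟩)
  refine ⟨C, h1.trans (hends ▸ huniv), le_trans (le_of_eq ?_) h2⟩
  rw [hps, List.map_map, matchW, Fin.sum_univ_def]
  congr 2
  refine List.map_congr_left fun i _ => ?_
  simp [pathWeight]

theorem exists_cycle_of_decomposition {n : ℕ} {w : Fin n → Fin n → ℝ} (hw : MetricWeight w)
    {T : List (List (Fin n))} (hT : ∀ L ∈ T, L ≠ [])
    (hflat : T.flatten.Perm Finset.univ.toList) :
    ∃ C : List (Fin n), C.Perm Finset.univ.toList ∧
      (T.map (pathWeight w)).sum + (T.map (closingWeight w)).sum / 2 ≤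
        pathWeight w C + closingWeight w C := by
  obtain ⟨bs, h1, h2, h3⟩ := exists_closes_of_closing hw T hT
  obtain ⟨C, h4, h5⟩ := (closes_blocks hw bs h1).exists_cycle hw T h2
  exact ⟨C, h4.trans hflat, h3 ▸ h5⟩

/-- In a metric complete graph on an even number `n = 2p` of vertices, there is
a Hamiltonian cycle `H` with `w(H) ≥ (5/8)·w(C*) + (1/2)·w(M*)`, where `C*` is a
maximum-weight cycle packing (vertex-disjoint cycles of length at least three covering all
vertices, modelled as a permutation with no fixed point and no 2-orbit) and `M*` is a
maximum-weight perfect matching. -/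
theorem stmt5 (n p : ℕ) (hp : n = 2 * p)
    (w : Fin n → Fin n → ℝ)
    (hnonneg : ∀ u v, 0 ≤ w u v) (hsymm : ∀ u v, w u v = w v u)
    (htri : ∀ u x v, w u v ≤ w u x + w x v)
    (Cstar : Equiv.Perm (Fin n))
    (hC1 : ∀ v, Cstar v ≠ v) (hC2 : ∀ v, Cstar (Cstar v) ≠ v)
    (hCmax : ∀ σ : Equiv.Perm (Fin n), (∀ v, σ v ≠ v) → (∀ v, σ (σ v) ≠ v) →
      (∑ v, w v (σ v)) ≤ ∑ v, w v (Cstar v))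
    (Mstar : Fin p × Fin 2 ≃ Fin n)
    (hMmax : ∀ M : Fin p × Fin 2 ≃ Fin n,
      matchW w (fun q => M q) ≤ matchW w (fun q => Mstar q)) :
    ∃ H : Fin n ≃ Fin n,
      hamW w H ≥ (5 / 8) * (∑ v, w v (Cstar v)) + (1 / 2) * matchW w (fun q => Mstar q) := by
  have hw : MetricWeight w := ⟨hnonneg, hsymm, htri⟩
  obtain ⟨T, hflat, hT⟩ := exists_cycle_decomposition (w := w) hC1 hC2 Finset.univ (by simp)
  have hsum : ∑ v, w v (Cstar v) =
      (T.map (pathWeight w)).sum + (T.map (closingWeight w)).sum := by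
    rw [← Finset.sum_map_toList, ← (hflat.map _).sum_eq, List.map_flatten, List.sum_flatten,
      List.map_map, ← List.sum_map_add]
    exact congrArg List.sum (List.map_congr_left fun L hL => (hT L hL).2)
  have hval : (T.map (cycleValue w)).sum =
      (T.map (pathWeight w)).sum / 4 + (T.map (closingWeight w)).sum * (3 / 4) := by
    clear hflat hT hsum
    induction T with
    | nil => simp
    | cons L T ih =>
      simp only [List.map_cons, List.sum_cons, ih, cycleValue]
      ring
  obtain ⟨C₁, h₁, hC₁⟩ := exists_cycle_of_matching hw Mstar (fun L hL => (hT L hL).1) hflat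
  obtain ⟨C₂, h₂, hC₂⟩ := exists_cycle_of_decomposition hw
    (fun L hL h => by simpa [h] using (hT L hL).1.1) hflat
  obtain ⟨H₁, hH₁⟩ := exists_hamW_eq (w := w) h₁
  obtain ⟨H₂, hH₂⟩ := exists_hamW_eq (w := w) h₂
  rcases le_total (hamW w H₁) (hamW w H₂) with h | h
  · exact ⟨H₂, by linarith⟩
  · exact ⟨H₁, by linarith⟩
end

section
/- Let m ≥ 1, and let v, a_1, b_1, a_2, b_2, …, a_m, b_m be 2m+1 distinct vertices of a metric complete graph with edge weights w. Suppose w(a_1,b_1) + w(a_m,b_m) ≥ (2/m)·Σ_{i=1}^{m} w(a_i,b_i). Then for each i there is a choice of orientation (t_i, h_i) with {t_i,h_i} = {a_i,b_i} such that the (2m+1)-cycle v t_1 h_1 t_2 h_2 ⋯ t_m h_m v has total weight at least ((3m+1)/(2m))·Σ_{i=1}^{m} w(a_i,b_i). -/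
open Finset

/-- Between the edges `p q` and `x y`, the four connecting edges weigh at least
as much as the two edges themselves. -/
lemma add_le_sum_connecting {V : Type*} (w : V → V → ℝ) (hsymm : ∀ u v, w u v = w v u)
    (htri : ∀ u x v, w u v ≤ w u x + w x v) (p q x y : V) :
    w p q + w x y ≤ w p x + w p y + w q x + w q y := by
  linarith [htri p x q, htri p y q, htri x p y, htri x q y, hsymm x q, hsymm y q, hsymm x p]

/-- Orientations of the edges that depend only on the parity of the index:
`c.1` is used at even positions and `c.2` at odd positions. -/
def parityChoice (c : Bool × Bool) (i : ℕ) : Bool := if i % 2 = 0 then c.1 else c.2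

lemma sum_parityChoice (f : Bool → ℝ) (i : ℕ) :
    ∑ c, f (parityChoice c i) = 2 * (f true + f false) := by
  rcases Nat.mod_two_eq_zero_or_one i with h | h <;>
    simp [parityChoice, h, Fintype.sum_prod_type] <;> ring

lemma sum_parityChoice_succ (f : Bool → Bool → ℝ) (i : ℕ) :
    ∑ c, f (parityChoice c i) (parityChoice c (i + 1)) =
      f true true + f true false + f false true + f false false := by
  rcases Nat.mod_two_eq_zero_or_one i with h | h
  · have h' : (i + 1) % 2 = 1 := by omega
    simp [parityChoice, h, h', Fintype.sum_prod_type]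
    ring
  · have h' : (i + 1) % 2 = 0 := by omega
    simp [parityChoice, h, h', Fintype.sum_prod_type]
    ring

/-- Let `m ≥ 1` and let `v, a_1, b_1, …, a_m, b_m` be `2m+1` distinct vertices of
a metric complete graph. If `w(a_1,b_1) + w(a_m,b_m) ≥ (2/m)·Σ_i w(a_i,b_i)`, then each edge
`a_i b_i` can be oriented as `(t_i, h_i)` so that the `(2m+1)`-cycle
`v t_1 h_1 t_2 h_2 ⋯ t_m h_m v` has weight at least `((3m+1)/(2m))·Σ_i w(a_i,b_i)`. -/
theorem stmt8 {V : Type*} (w : V → V → ℝ)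
    (hnonneg : ∀ u v, 0 ≤ w u v) (hsymm : ∀ u v, w u v = w v u)
    (htri : ∀ u x v, w u v ≤ w u x + w x v)
    (m : ℕ) (hm : 0 < m) (v : V) (a b : Fin m → V)
    (hav : ∀ i, a i ≠ v) (hbv : ∀ i, b i ≠ v)
    (hab : ∀ i j, a i ≠ b j)
    (ha : Function.Injective a) (hb : Function.Injective b)
    (hbig : w (a ⟨0, hm⟩) (b ⟨0, hm⟩) + w (a ⟨m - 1, by omega⟩) (b ⟨m - 1, by omega⟩)
      ≥ (2 / (m : ℝ)) * ∑ i, w (a i) (b i)) :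
    ∃ t h : Fin m → V,
      (∀ i, (t i = a i ∧ h i = b i) ∨ (t i = b i ∧ h i = a i)) ∧
      w v (t ⟨0, hm⟩) + (∑ i, w (t i) (h i)) +
          (∑ i : Fin m, if (i : ℕ) + 1 < m then w (h i) (t (finRotate m i)) else 0) +
          w (h ⟨m - 1, by omega⟩) v
        ≥ ((3 * (m : ℝ) + 1) / (2 * (m : ℝ))) * ∑ i, w (a i) (b i) := by
  obtain ⟨n, rfl⟩ : ∃ n, m = n + 1 := ⟨m - 1, by omega⟩
  have hzero : (⟨0, hm⟩ : Fin (n + 1)) = 0 := rfl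
  have hlast : (⟨n + 1 - 1, by omega⟩ : Fin (n + 1)) = Fin.last n := rfl
  simp only [hzero, hlast] at hbig ⊢
  let T : Bool → Fin (n + 1) → V := fun s i => if s then a i else b i
  let t : Bool × Bool → Fin (n + 1) → V := fun c i => T (parityChoice c i) i
  let h : Bool × Bool → Fin (n + 1) → V := fun c i => T (!parityChoice c i) i
  have hpath : ∀ c, (∑ i : Fin (n + 1),
      if (i : ℕ) + 1 < n + 1 then w (h c i) (t c (finRotate (n + 1) i)) else 0) =
      ∑ i : Fin n, w (h c i.castSucc) (t c i.succ) := by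
    intro c
    rw [Fin.sum_univ_castSucc]
    simp
  have hstart : w (a 0) (b 0) * 2 ≤ ∑ c, w v (t c 0) := by
    refine le_of_le_of_eq ?_ (sum_parityChoice (fun s => w v (T s 0)) (0 : Fin (n + 1))).symm
    simp only [T, if_true, Bool.false_eq_true, if_false]
    linarith [htri (a 0) v (b 0), hsymm (a 0) v]
  have hend : w (a (Fin.last n)) (b (Fin.last n)) * 2 ≤ ∑ c, w (h c (Fin.last n)) v := by
    refine le_of_le_of_eq ?_
      (sum_parityChoice (fun s => w (T (!s) (Fin.last n)) v) (Fin.last n)).symm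
    simp only [T, Bool.not_true, Bool.not_false, if_true, Bool.false_eq_true, if_false]
    linarith [htri (a (Fin.last n)) v (b (Fin.last n)), hsymm (b (Fin.last n)) v]
  have hedge : ∀ c, ∑ i, w (t c i) (h c i) = ∑ i, w (a i) (b i) := by
    intro c
    refine Finset.sum_congr rfl fun i _ => ?_
    simp only [t, h, T]
    cases parityChoice c i <;> simp [hsymm (b i) (a i)]
  have hmid : ∀ i : Fin n, w (a i.castSucc) (b i.castSucc) + w (a i.succ) (b i.succ) ≤
      ∑ c, w (h c i.castSucc) (t c i.succ) := by
    intro i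
    refine le_of_le_of_eq ?_
      (sum_parityChoice_succ (fun s s' => w (T (!s) i.castSucc) (T s' i.succ)) i).symm
    simp only [T, Bool.not_true, Bool.not_false, if_true, Bool.false_eq_true, if_false]
    linarith [add_le_sum_connecting w hsymm htri (a i.castSucc) (b i.castSucc)
      (a i.succ) (b i.succ)]
  have hmids := Finset.sum_le_sum fun i (_ : i ∈ (univ : Finset (Fin n))) => hmid i
  rw [Finset.sum_add_distrib, Finset.sum_comm] at hmids
  have hsucc := Fin.sum_univ_succ fun i => w (a i) (b i)
  have hcast := Fin.sum_univ_castSucc fun i => w (a i) (b i)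
  have hcoef : (3 * ((n + 1 : ℕ) : ℝ) + 1) / (2 * ((n + 1 : ℕ) : ℝ)) =
      3 / 2 + 1 / 4 * (2 / ((n + 1 : ℕ) : ℝ)) := by
    field_simp
    ring
  have htotal : ∑ _c : Bool × Bool, ((3 * ((n + 1 : ℕ) : ℝ) + 1) / (2 * ((n + 1 : ℕ) : ℝ))) *
      ∑ i, w (a i) (b i) ≤ ∑ c, (w v (t c 0) + (∑ i, w (t c i) (h c i)) +
        (∑ i : Fin (n + 1),
          if (i : ℕ) + 1 < n + 1 then w (h c i) (t c (finRotate (n + 1) i)) else 0) +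
        w (h c (Fin.last n)) v) := by
    simp only [hpath, hedge, Finset.sum_add_distrib, hcoef]
    simp only [Finset.sum_const, Finset.card_univ, Fintype.card_prod, Fintype.card_bool,
      nsmul_eq_mul]
    push_cast at hbig ⊢
    linarith
  obtain ⟨c, -, hc⟩ := Finset.exists_le_of_sum_le Finset.univ_nonempty htotal
  refine ⟨t c, h c, fun i => ?_, hc⟩
  simp only [t, h, T]
  cases parityChoice c i <;> simp
end

section
/- Let G be a metric complete graph on n vertices where k is even, k ≥ 4, and k divides n, and let M*_p be a maximum-weight matching of size p = (n/k)·(k-2)/2 in G. Then there exists a k-path packing P'_k of G with w(P'_k) ≥ ((3k-4)/(2k-4))·w(M*_p). -/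
open Finset

/-- Position `j` of a path on `2 * q + 2` vertices after swapping the two positions
`2 * b - 1`, `2 * b` of each block `1 ≤ b ≤ q`: even blocks are swapped when `α` holds,
odd blocks when `β` holds. The two end positions are fixed. -/
def reorientPos (q : ℕ) (α β : Bool) (j : ℕ) : ℕ :=
  if j = 0 ∨ 2 * q + 1 ≤ j then j
  else if (if (j + 1) / 2 % 2 = 0 then α else β) then
    (if j % 2 = 1 then j + 1 else j - 1)
  else j

lemma reorientPos_lt {q : ℕ} {α β : Bool} {j : ℕ} (hj : j < 2 * q + 2) :
    reorientPos q α β j < 2 * q + 2 := by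
  unfold reorientPos
  split_ifs <;> omega

lemma reorientPos_reorientPos (q : ℕ) (α β : Bool) (j : ℕ) :
    reorientPos q α β (reorientPos q α β j) = j := by
  cases α <;> cases β <;> simp only [reorientPos] <;> grind

/-- The packing obtained from `x` by reversing the blocks selected by `α` and `β`. -/
def reorient {n m : ℕ} (q : ℕ) (α β : Bool) (x : Fin m × Fin (2 * q + 2) ≃ Fin n) :
    Fin m × Fin (2 * q + 2) ≃ Fin n :=
  ((Equiv.refl (Fin m)).prodCongr
    (Function.Involutive.toPerm (fun j : Fin (2 * q + 2) =>
      (⟨reorientPos q α β j, reorientPos_lt j.isLt⟩ : Fin (2 * q + 2)))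
      fun j => Fin.ext (reorientPos_reorientPos q α β j))).trans x

lemma reorient_apply_ofNat {n m q : ℕ} (α β : Bool) (x : Fin m × Fin (2 * q + 2) ≃ Fin n)
    (i : Fin m) (j : ℕ) (hj : j < 2 * q + 2) :
    reorient q α β x (i, Fin.ofNat (2 * q + 2) j) =
      x (i, Fin.ofNat (2 * q + 2) (reorientPos q α β j)) := by
  have h := reorientPos_lt (α := α) (β := β) hj
  rw [show Fin.ofNat (2 * q + 2) j = ⟨j, hj⟩ from Fin.ext (Nat.mod_eq_of_lt hj),
    show Fin.ofNat (2 * q + 2) (reorientPos q α β j) = ⟨reorientPos q α β j, h⟩ from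
      Fin.ext (Nat.mod_eq_of_lt h)]
  rfl

lemma pathW_eq_sum_range {n m l : ℕ} (w : Fin n → Fin n → ℝ)
    (f : Fin m × Fin (l + 1) ≃ Fin n) :
    pathW w f = ∑ i, ∑ j ∈ range l,
      w (f (i, Fin.ofNat (l + 1) j)) (f (i, Fin.ofNat (l + 1) (j + 1))) := by
  unfold pathW
  refine Finset.sum_congr rfl fun i _ => ?_
  rw [Fin.sum_univ_castSucc, Finset.sum_range]
  simp only [Fin.val_castSucc, Fin.val_last, lt_irrefl, if_false, add_zero]
  refine Finset.sum_congr rfl fun j _ => ?_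
  have h1 : Fin.ofNat (l + 1) (j : ℕ) = j.castSucc :=
    Fin.ext (Nat.mod_eq_of_lt (by omega))
  have h2 : Fin.ofNat (l + 1) ((j : ℕ) + 1) = finRotate (l + 1) j.castSucc := by
    have := finRotate_of_lt j.isLt
    rw [show j.castSucc = ⟨(j : ℕ), by omega⟩ from rfl, this]
    exact Fin.ext (Nat.mod_eq_of_lt (by omega))
  rw [if_pos (by omega), h1, h2]

lemma sum_range_two_mul_add_one (g : ℕ → ℝ) (q : ℕ) :
    ∑ j ∈ range (2 * q + 1), g j =
      ∑ t ∈ range (q + 1), g (2 * t) + ∑ t ∈ range q, g (2 * t + 1) := by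
  induction q with
  | zero => simp
  | succ q ih =>
    rw [show 2 * (q + 1) + 1 = 2 * q + 1 + 1 + 1 by ring, Finset.sum_range_succ,
      Finset.sum_range_succ, ih, Finset.sum_range_succ _ (q + 1), Finset.sum_range_succ _ q,
      Finset.sum_range_succ _ q, show 2 * q + 1 + 1 = 2 * (q + 1) by ring]
    ring

/-- Any injective matching `M` extends to a path packing whose `t`-th inner pairs of positions
are the edges of `M`. -/
lemma exists_equiv_extending_matching {n m p q : ℕ} (hn : n = m * (2 * q + 2))
    (hp : m * q = p) (M : Fin p × Fin 2 → Fin n) (hM : Function.Injective M) :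
    ∃ x : Fin m × Fin (2 * q + 2) ≃ Fin n, ∀ w : Fin n → Fin n → ℝ,
      matchW w M = ∑ i, ∑ t ∈ range q,
        w (x (i, Fin.ofNat (2 * q + 2) (2 * t + 1)))
          (x (i, Fin.ofNat (2 * q + 2) (2 * t + 2))) := by
  subst hp
  let inner : (Fin m × Fin q) × Fin 2 → Fin m × Fin (2 * q + 2) :=
    fun z => (z.1.1, ⟨2 * z.1.2 + 1 + z.2, by omega⟩)
  have hinner : Function.Injective inner := by
    rintro ⟨⟨i, t⟩, c⟩ ⟨⟨i', t'⟩, c'⟩ h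
    simp only [inner, Prod.mk.injEq, Fin.mk.injEq] at h
    obtain ⟨rfl, h⟩ := h
    simp only [Prod.mk.injEq, Fin.ext_iff, true_and]
    omega
  let M' : (Fin m × Fin q) × Fin 2 → Fin n := fun z => M (finProdFinEquiv z.1, z.2)
  have hM' : Function.Injective M' := by
    rintro ⟨z, c⟩ ⟨z', c'⟩ h
    simpa using hM h
  obtain ⟨g, hg⟩ : ∃ g : Fin m × Fin (2 * q + 2) ≃ Fin n, ∀ z, g (inner z) = M' z := by
    let e : Fin m × Fin (2 * q + 2) ≃ Fin n := finProdFinEquiv.trans (finCongr hn.symm)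
    let σ : {a // a ∈ Set.range inner} ≃ {a // a ∈ Set.range (e.symm ∘ M')} :=
      (Equiv.ofInjective _ hinner).symm.trans
        (Equiv.ofInjective _ (e.symm.injective.comp hM'))
    classical
    refine ⟨σ.extendSubtype.trans e, fun z => ?_⟩
    have h := σ.extendSubtype_apply_of_mem (inner z) ⟨z, rfl⟩
    have h' : (Equiv.ofInjective _ hinner).symm ⟨inner z, ⟨z, rfl⟩⟩ = z := by
      rw [Equiv.symm_apply_eq]; rfl
    simp only [Equiv.trans_apply, h]
    simp [σ, h']
  refine ⟨g, fun w => ?_⟩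
  unfold matchW
  rw [← finProdFinEquiv.sum_comp, Fintype.sum_prod_type]
  refine Finset.sum_congr rfl fun i _ => ?_
  rw [Finset.sum_range]
  refine Finset.sum_congr rfl fun t _ => ?_
  have h0 := hg ((i, t), 0)
  have h1 := hg ((i, t), 1)
  simp only [inner, M'] at h0 h1
  have hpos : ∀ c : ℕ, (hc : c < 2 * q + 2) → Fin.ofNat (2 * q + 2) c = ⟨c, hc⟩ :=
    fun c hc => Fin.ext (Nat.mod_eq_of_lt hc)
  rw [← h0, ← h1, hpos _ (by omega), hpos _ (by omega)]
  rfl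

/-- Averaged over the four reorientations, the weight of a path on `2 * q + 2` vertices is at
least `(3 * q + 1) / (2 * q)` times the weight of its `q` inner pairs. -/
lemma sum_reorient_path_ge {n q : ℕ} (w : Fin n → Fin n → ℝ)
    (hsymm : ∀ u v, w u v = w v u) (htri : ∀ u x v, w u v ≤ w u x + w x v) (y : ℕ → Fin n) (hq : 1 ≤ q) :
    4 * (((3 * q + 1) / (2 * q)) * ∑ t ∈ range q, w (y (2 * t + 1)) (y (2 * t + 2))) ≤
      ∑ α, ∑ β, ∑ j ∈ range (2 * q + 1),
        w (y (reorientPos q α β j)) (y (reorientPos q α β (j + 1))) := by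
  have hq0 : (0 : ℝ) < q := by exact_mod_cast hq
  set E : ℕ → ℝ := fun b => w (y (2 * b - 1)) (y (2 * b))
  have hEdef : ∀ t, w (y (2 * t + 1)) (y (2 * t + 2)) = E (t + 1) := fun t => rfl
  have hmatch : ∀ α β, ∀ t ∈ range q,
      w (y (reorientPos q α β (2 * t + 1))) (y (reorientPos q α β (2 * t + 1 + 1))) =
        E (t + 1) := by
    intro α β t ht
    rw [Finset.mem_range] at ht
    have hcase : (reorientPos q α β (2 * t + 1) = 2 * t + 1 ∧
        reorientPos q α β (2 * t + 1 + 1) = 2 * t + 2) ∨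
        (reorientPos q α β (2 * t + 1) = 2 * t + 2 ∧
        reorientPos q α β (2 * t + 1 + 1) = 2 * t + 1) := by
      cases α <;> cases β <;> simp only [reorientPos] <;> grind
    rcases hcase with ⟨h1, h2⟩ | ⟨h1, h2⟩ <;> rw [h1, h2, ← hEdef]
    exact hsymm _ _
  set C : ℕ → ℝ := fun t => ∑ α, ∑ β,
    w (y (reorientPos q α β (2 * t))) (y (reorientPos q α β (2 * t + 1))) with hC
  have hleft : ∀ t, 1 ≤ t → t ≤ q → 2 * E t ≤ C t := by
    intro t h1 h2
    have htri' : ∀ z, E t ≤ w (y (2 * t - 1)) z + w (y (2 * t)) z := fun z => by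
      rw [hsymm (y (2 * t)) z]; exact htri _ _ _
    simp only [hC, Fintype.sum_bool]
    rcases Nat.mod_two_eq_zero_or_one t with ht | ht
    · have e1 : ∀ α β, reorientPos q α β (2 * t) = if α then 2 * t - 1 else 2 * t := by
        intro α β
        cases α <;> cases β <;> simp only [reorientPos] <;> grind
      have e2 : ∀ β, reorientPos q true β (2 * t + 1) = reorientPos q false β (2 * t + 1) := by
        intro β
        cases β <;> simp only [reorientPos] <;> grind
      simp only [e1, e2, if_true, Bool.false_eq_true, if_false]
      linarith [htri' (y (reorientPos q false true (2 * t + 1))),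
        htri' (y (reorientPos q false false (2 * t + 1)))]
    · have e1 : ∀ α β, reorientPos q α β (2 * t) = if β then 2 * t - 1 else 2 * t := by
        intro α β
        cases α <;> cases β <;> simp only [reorientPos] <;> grind
      have e2 : ∀ α, reorientPos q α true (2 * t + 1) = reorientPos q α false (2 * t + 1) := by
        intro α
        cases α <;> simp only [reorientPos] <;> grind
      simp only [e1, e2, if_true, Bool.false_eq_true, if_false]
      linarith [htri' (y (reorientPos q true false (2 * t + 1))),
        htri' (y (reorientPos q false false (2 * t + 1)))]
  have hright : ∀ t, t < q → 2 * E (t + 1) ≤ C t := by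
    intro t h
    have htri' : ∀ z, E (t + 1) ≤ w z (y (2 * t + 1)) + w z (y (2 * t + 2)) := fun z => by
      rw [hsymm z (y (2 * t + 1))]; exact htri _ _ _
    simp only [hC, Fintype.sum_bool]
    rcases Nat.mod_two_eq_zero_or_one t with ht | ht
    · have e1 : ∀ α β,
          reorientPos q α β (2 * t + 1) = if β then 2 * t + 2 else 2 * t + 1 := by
        intro α β
        cases α <;> cases β <;> simp only [reorientPos] <;> grind
      have e2 : ∀ α, reorientPos q α true (2 * t) = reorientPos q α false (2 * t) := by
        intro α
        cases α <;> simp only [reorientPos] <;> grind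
      simp only [e1, e2, if_true, Bool.false_eq_true, if_false]
      linarith [htri' (y (reorientPos q true false (2 * t))),
        htri' (y (reorientPos q false false (2 * t)))]
    · have e1 : ∀ α β,
          reorientPos q α β (2 * t + 1) = if α then 2 * t + 2 else 2 * t + 1 := by
        intro α β
        cases α <;> cases β <;> simp only [reorientPos] <;> grind
      have e2 : ∀ β, reorientPos q true β (2 * t) = reorientPos q false β (2 * t) := by
        intro β
        cases β <;> simp only [reorientPos] <;> grind
      simp only [e1, e2, if_true, Bool.false_eq_true, if_false]
      linarith [htri' (y (reorientPos q false true (2 * t))),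
        htri' (y (reorientPos q false false (2 * t)))]
  have hconn : ∀ t ∈ range (q + 1), 2 * (t * E t + (q - t) * E (t + 1)) ≤ q * C t := by
    intro t ht
    rw [Finset.mem_range] at ht
    have hl : (t : ℝ) * (2 * E t) ≤ t * C t := by
      rcases Nat.eq_zero_or_pos t with rfl | h
      · simp
      · exact mul_le_mul_of_nonneg_left (hleft t h (by omega)) (Nat.cast_nonneg t)
    have hr : ((q : ℝ) - t) * (2 * E (t + 1)) ≤ (q - t) * C t := by
      rcases (show t ≤ q by omega).eq_or_lt with rfl | h
      · simp
      · exact mul_le_mul_of_nonneg_left (hright t h) (sub_nonneg.2 (by exact_mod_cast h.le))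
    linarith
  have hsumE : ∑ t ∈ range (q + 1), ((t : ℝ) * E t + (q - t) * E (t + 1)) =
      (q + 1) * ∑ t ∈ range q, E (t + 1) := by
    rw [Finset.sum_add_distrib, Finset.sum_range_succ', Finset.sum_range_succ _ q,
      Finset.mul_sum]
    simp only [Nat.cast_zero, zero_mul, add_zero, sub_self, ← Finset.sum_add_distrib]
    refine Finset.sum_congr rfl fun t _ => ?_
    push_cast
    ring
  have htotal : ∑ α, ∑ β, ∑ j ∈ range (2 * q + 1),
      w (y (reorientPos q α β j)) (y (reorientPos q α β (j + 1))) =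
      ∑ t ∈ range (q + 1), C t + 4 * ∑ t ∈ range q, E (t + 1) := by
    simp only [sum_range_two_mul_add_one
      (fun j => w (y (reorientPos q _ _ j)) (y (reorientPos q _ _ (j + 1))))]
    simp only [Finset.sum_congr rfl (hmatch _ _), hC, Fintype.sum_bool, Finset.sum_add_distrib]
    ring
  have hmain : 2 * ((q + 1) * ∑ t ∈ range q, E (t + 1)) ≤ q * ∑ t ∈ range (q + 1), C t := by
    rw [← hsumE, Finset.mul_sum, Finset.mul_sum]
    exact Finset.sum_le_sum hconn
  rw [htotal]
  simp only [hEdef]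
  set S := ∑ t ∈ range q, E (t + 1)
  rw [show 4 * ((3 * (q : ℝ) + 1) / (2 * q) * S) = (2 * ((q + 1) * S) + q * (4 * S)) / q by
    field_simp; ring, div_le_iff₀ hq0]
  linarith


open Finset

/-- In a metric complete graph on `n = m * k` vertices with `k` even, `k ≥ 4`,
let `M*_p` be a maximum-weight matching of size `p = (n/k)·(k-2)/2` (i.e. `2p = m(k-2)`).
Then there is a `k`-path packing `P'_k` with `w(P'_k) ≥ ((3k-4)/(2k-4))·w(M*_p)`. -/
theorem stmt11 (n k m p : ℕ) (hkeven : Even k) (hk : 4 ≤ k) (hn : n = m * k)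
    (hp : 2 * p = m * (k - 2))
    (w : Fin n → Fin n → ℝ)
    (hnonneg : ∀ u v, 0 ≤ w u v) (hsymm : ∀ u v, w u v = w v u)
    (htri : ∀ u x v, w u v ≤ w u x + w x v)
    (Mstar : Fin p × Fin 2 → Fin n) (hMinj : Function.Injective Mstar)
    (hMmax : ∀ x : Fin p × Fin 2 → Fin n, Function.Injective x →
      matchW w x ≤ matchW w Mstar) :
    ∃ P : Fin m × Fin k ≃ Fin n,
      pathW w P ≥ ((3 * (k : ℝ) - 4) / (2 * (k : ℝ) - 4)) * matchW w Mstar := by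
  obtain ⟨h, rfl⟩ := hkeven
  obtain ⟨q, rfl⟩ : ∃ q, h = q + 1 := ⟨h - 1, by omega⟩
  have hk2 : q + 1 + (q + 1) = 2 * q + 2 := by ring
  have hq : 1 ≤ q := by omega
  generalize q + 1 + (q + 1) = k at *
  subst hk2
  have hpq : m * q = p := by
    have : 2 * p = m * (2 * q) := by simpa using hp
    have : 2 * p = 2 * (m * q) := by rw [this]; ring
    omega
  obtain ⟨x, hx⟩ := exists_equiv_extending_matching hn hpq Mstar hMinj
  have hq0 : (0 : ℝ) < q := by exact_mod_cast hq
  set y : Fin m → ℕ → Fin n := fun i j => x (i, Fin.ofNat (2 * q + 2) j)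
  have hM : matchW w Mstar = ∑ i, ∑ t ∈ range q, w (y i (2 * t + 1)) (y i (2 * t + 2)) := by
    rw [hx w]
  have hpath : ∀ α β, pathW w (reorient q α β x) =
      ∑ i, ∑ j ∈ range (2 * q + 1),
        w (y i (reorientPos q α β j)) (y i (reorientPos q α β (j + 1))) := by
    intro α β
    rw [pathW_eq_sum_range]
    refine Finset.sum_congr rfl fun i _ => Finset.sum_congr rfl fun j hj => ?_
    rw [Finset.mem_range] at hj
    rw [reorient_apply_ofNat _ _ _ _ _ (by omega), reorient_apply_ofNat _ _ _ _ _ (by omega)]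
  have havg : ∑ α, ∑ β, pathW w (reorient q α β x) ≥
      4 * (((3 * q + 1) / (2 * q)) * matchW w Mstar) := by
    have hswap : ∑ α, ∑ β, pathW w (reorient q α β x) = ∑ i, ∑ α, ∑ β,
        ∑ j ∈ range (2 * q + 1),
          w (y i (reorientPos q α β j)) (y i (reorientPos q α β (j + 1))) := by
      simp only [hpath, Fintype.sum_bool, Finset.sum_add_distrib]
    rw [hswap, hM, Finset.mul_sum, Finset.mul_sum]
    exact Finset.sum_le_sum fun i _ => sum_reorient_path_ge w hsymm htri (y i) hq
  have hcoef : (3 * ((2 * q + 2 : ℕ) : ℝ) - 4) / (2 * ((2 * q + 2 : ℕ) : ℝ) - 4) =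
      (3 * q + 1) / (2 * q) := by
    push_cast
    rw [div_eq_div_iff (by linarith) (by linarith)]
    ring
  rw [hcoef]
  by_contra! hcon
  simp only [Fintype.sum_bool] at havg
  linarith [hcon (reorient q true true x), hcon (reorient q true false x),
    hcon (reorient q false true x), hcon (reorient q false false x)]
end
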